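/- arXiv:2603.05443 — 4 statements merged into one kernel-verified Lean document; each statement's English description precedes it below -/
import Mathlib

section
/- For every integer k ≥ 2 there exists a constant c_k > 0 such that the following holds: if X is a finite set of size n ≥ 1 and F ⊆ 2^X is a k-cross-free family of subsets of X, then |F| ≤ c_k · n. -/
open Finset

/-- Two subsets `A` and `B` of a ground set `X` are crossing if none of the four sets
`A \ B`, `B \ A`, `A ∩ B`, `X \ (A ∪ B)` is empty. -/
def Crossing {α : Type*} [DecidableEq α] (X A B : Finset α) : Prop :=
  (A \ B).Nonempty ∧ (B \ A).Nonempty ∧ (A ∩ B).Nonempty ∧ (X \ (A ∪ B)).Nonempty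

/-- A family `F ⊆ 2^X` is `k`-cross-free if it contains no `k` members that are
pairwise crossing. -/
def CrossFreeFam {α : Type*} [DecidableEq α] (k : ℕ) (X : Finset α)
    (F : Finset (Finset α)) : Prop :=
  ¬ ∃ S : Finset (Finset α), S ⊆ F ∧ S.card = k ∧
      (S : Set (Finset α)).Pairwise (Crossing X)

/-- A family is `k`-weakly-cross-free if it contains no `k` distinct members that pairwise
intersect and are pairwise incomparable. -/
def WeakCrossFree {α : Type*} [DecidableEq α] (k : ℕ) (F : Finset (Finset α)) : Prop :=
  ∀ S ⊆ F, (∀ A ∈ S, ∀ B ∈ S, A ≠ B → ¬ A ⊆ B ∧ (A ∩ B).Nonempty) → S.card < k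

/-- Every finite indexed cover contains an irredundant subcover. -/
lemma exists_irredundant_subcover {ι α : Type*} [DecidableEq ι] [DecidableEq α]
    (f : ι → Finset α) (G : Finset ι) :
    ∃ S ⊆ G, S.biUnion f = G.biUnion f ∧
      ∀ i ∈ S, ∃ y ∈ f i, ∀ j ∈ S, j ≠ i → y ∉ f j := by
  induction G using Finset.strongInduction with
  | H G ih =>
    by_cases h : ∀ i ∈ G, ∃ y ∈ f i, ∀ j ∈ G, j ≠ i → y ∉ f j
    · exact ⟨G, Subset.rfl, rfl, h⟩
    · push Not at h
      obtain ⟨i, hi, h⟩ := h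
      obtain ⟨S, hS, hU, hp⟩ := ih (G.erase i) (erase_ssubset hi)
      refine ⟨S, hS.trans (erase_subset _ _), hU.trans ?_, hp⟩
      ext y
      simp only [mem_biUnion, mem_erase]
      constructor
      · rintro ⟨j, ⟨-, hj⟩, hy⟩
        exact ⟨j, hj, hy⟩
      · rintro ⟨j, hj, hy⟩
        by_cases hji : j = i
        · subst hji
          obtain ⟨l, hl, hlj, hyl⟩ := h y hy
          exact ⟨l, ⟨hlj, hl⟩, hyl⟩
        · exact ⟨j, ⟨hji, hj⟩, hy⟩

namespace WeakCrossFree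

variable {α : Type*} [DecidableEq α] {k : ℕ} {F : Finset (Finset α)}

/-- The members through a common point, if they have bounded size, have a small union. -/
lemma card_biUnion_le (hF : WeakCrossFree k F) {G : Finset (Finset α)} (hG : G ⊆ F) {x : α}
    (hx : ∀ A ∈ G, x ∈ A) {m : ℕ} (hm : ∀ A ∈ G, A.card ≤ m) :
    (G.biUnion id).card ≤ (k - 1) * m := by
  obtain ⟨S, hSG, hU, hp⟩ := exists_irredundant_subcover id G
  have hS : S.card < k := by
    refine hF S (hSG.trans hG) fun A hA B hB hAB => ⟨fun hsub => ?_, x, ?_⟩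
    · obtain ⟨y, hy, hyS⟩ := hp A hA
      exact hyS B hB (Ne.symm hAB) (hsub hy)
    · exact mem_inter.2 ⟨hx A (hSG hA), hx B (hSG hB)⟩
  rw [← hU]
  refine (card_biUnion_le_card_mul S id m fun A hA => hm A (hSG hA)).trans ?_
  exact Nat.mul_le_mul_right _ (by omega)

/-- There are few points of `D` missed by some member of `F` that misses at most `b` points
of `D`. -/
lemma card_biUnion_sdiff_le (hF : WeakCrossFree k F) (D : Finset α) {b : ℕ}
    (hD : 2 * b < D.card) :
    ((F.filter fun S => (D \ S).card ≤ b).biUnion fun S => D \ S).card ≤ (k - 1) * b := by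
  obtain ⟨S, hSG, hU, hp⟩ :=
    exists_irredundant_subcover (fun S => D \ S) (F.filter fun S => (D \ S).card ≤ b)
  have hb : ∀ A ∈ S, (D \ A).card ≤ b := fun A hA => (mem_filter.1 (hSG hA)).2
  have hS : S.card < k := by
    refine hF S (hSG.trans (filter_subset _ _)) fun A hA B hB hAB => ⟨fun hsub => ?_, ?_⟩
    · obtain ⟨y, hy, hyS⟩ := hp B hB
      have := hyS A hA hAB
      simp only [mem_sdiff] at this hy
      exact hy.2 (hsub (by tauto))
    · by_contra hne
      rw [not_nonempty_iff_eq_empty] at hne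
      have hsub : D ⊆ (D \ A) ∪ (D \ B) := by
        intro z hz
        have hz' : z ∉ A ∩ B := by simp [hne]
        simp only [mem_inter, mem_union, mem_sdiff] at hz' ⊢
        tauto
      have h1 := card_le_card hsub
      have h2 := card_union_le (D \ A) (D \ B)
      have h3 := hb A hA
      have h4 := hb B hB
      omega
  rw [← hU]
  refine (card_biUnion_le_card_mul S _ b hb).trans ?_
  exact Nat.mul_le_mul_right _ (by omega)

/-- The members through a common point contain a long chain. -/
lemma exists_chain (hF : WeakCrossFree k F) (x : α) (G : Finset (Finset α)) (hG : G ⊆ F)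
    (hx : ∀ A ∈ G, x ∈ A) :
    ∃ C ⊆ G, IsChain (· ⊆ ·) (C : Set (Finset α)) ∧ G.card ≤ (k - 1) * C.card := by
  induction G using Finset.strongInduction with
  | H G ih =>
    rcases G.eq_empty_or_nonempty with rfl | hne
    · exact ⟨∅, Subset.rfl, by simp [IsChain], by simp⟩
    set M := G.filter fun A => ∀ B ∈ G, A ⊆ B → A = B with hM
    have hMk : M.card < k := by
      refine hF M ((filter_subset _ _).trans hG) fun A hA B hB hAB => ⟨fun hsub => ?_, x, ?_⟩
      · exact hAB ((mem_filter.1 hA).2 B (mem_filter.1 hB).1 hsub)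
      · exact mem_inter.2 ⟨hx A (mem_filter.1 hA).1, hx B (mem_filter.1 hB).1⟩
    have hmax : ∀ A ∈ G, ∃ B ∈ M, A ⊆ B := by
      intro A hA
      obtain ⟨B, hAB, hB⟩ := G.exists_le_maximal hA
      exact ⟨B, mem_filter.2 ⟨hB.prop, fun C hC hBC => hB.eq_of_le hC hBC⟩, hAB⟩
    obtain ⟨A₀, hA₀⟩ := hne
    obtain ⟨B₀, hB₀, -⟩ := hmax A₀ hA₀
    have hss : G \ M ⊂ G := sdiff_ssubset (filter_subset _ _) ⟨B₀, hB₀⟩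
    obtain ⟨C, hC, hch, hcard⟩ := ih (G \ M) hss (hss.subset.trans hG)
      fun A hA => hx A (hss.subset hA)
    obtain ⟨B, hB, hBC⟩ : ∃ B ∈ M, ∀ A ∈ C, A ⊆ B := by
      rcases C.eq_empty_or_nonempty with rfl | hCne
      · exact ⟨B₀, hB₀, by simp⟩
      · obtain ⟨T, hT, hTmax⟩ := C.exists_max_image card hCne
        obtain ⟨B, hB, hTB⟩ := hmax T (hss.subset (hC hT))
        refine ⟨B, hB, fun A hA => ?_⟩
        rcases hch.total hA hT with h | h
        · exact h.trans hTB
        · exact (eq_of_subset_of_card_le h (hTmax A hA)).symm.subset.trans hTB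
    have hBnot : B ∉ C := fun h => (mem_sdiff.1 (hC h)).2 hB
    refine ⟨insert B C, insert_subset (mem_filter.1 hB).1 (hC.trans hss.subset), ?_, ?_⟩
    · rw [coe_insert]
      exact hch.insert fun A hA _ => Or.inr (hBC A hA)
    · rw [card_insert_of_notMem hBnot, mul_add, mul_one]
      have h1 := card_sdiff_add_card_eq_card (filter_subset (fun A => ∀ B ∈ G, A ⊆ B → A = B) G)
      rw [← hM] at h1
      omega

end WeakCrossFree

/-- `y` is captured by `G` with step `J` if some subfamily of `G` has a member `D` through `y`
from which one can descend, in steps losing at most `J` elements, until `y` is lost, and `y`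
belongs to every member of `F` that contains all but at most `k * J` elements of `D`. -/
def Captured {α : Type*} [DecidableEq α] (k : ℕ) (F G : Finset (Finset α)) (J : ℕ)
    (y : α) : Prop :=
  ∃ C ⊆ G, ∃ D ∈ C, y ∈ D ∧
    (∀ S ∈ C, y ∈ S → ∃ R ∈ C, R ⊂ S ∧ (S \ R).card ≤ J) ∧
    ∀ S ∈ F, (D \ S).card ≤ k * J → y ∈ S

/-- A point is captured in fewer than `k` families of separated sizes. -/
lemma WeakCrossFree.card_captured_lt {α : Type*} [DecidableEq α] {k : ℕ}
    {F : Finset (Finset α)} (hF : WeakCrossFree k F) (G : ℕ → Finset (Finset α))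
    (hGF : ∀ i, G i ⊆ F) (hG : ∀ i j, i < j → ∀ A ∈ G i, ∀ B ∈ G j, A.card < B.card)
    {J : ℕ} {y : α} (T : Finset ℕ) (hT : ∀ i ∈ T, Captured k F (G i) J y) :
    T.card < k := by
  by_contra! hTk
  obtain ⟨T', hT'T, hT'⟩ := exists_subset_card_eq hTk
  replace hT : ∀ i ∈ T', Captured k F (G i) J y := fun i hi => hT i (hT'T hi)
  have key : ∀ U : Finset ℕ, U.card ≤ k → (∀ i ∈ U, Captured k F (G i) J y) →
      ∃ S : ℕ → Finset α, ∀ i ∈ U, S i ∈ G i ∧ y ∈ S i ∧ (∀ j ∈ U, i < j → ¬ S i ⊆ S j) ∧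
        ∃ R ∈ F, (S i \ R).card ≤ J ∧ (y ∈ R → ∃ j ∈ U, i < j ∧ R ⊆ S j) := by
    intro U
    induction U using Finset.induction_on_min with
    | empty => exact fun _ _ => ⟨fun _ => ∅, by simp⟩
    | insert a U ha ih =>
      intro hUk hU
      have haU : a ∉ U := fun h => lt_irrefl _ (ha a h)
      rw [card_insert_of_notMem haU] at hUk
      obtain ⟨S, hS⟩ := ih (by omega) fun i hi => hU i (mem_insert_of_mem hi)
      obtain ⟨C, hCG, D, hDC, hyD, hstep, hbad⟩ := hU a (mem_insert_self _ _)
      have hD : ∀ m : ℕ, ∀ j ∈ U, ∀ c, (U.filter (j ≤ ·)).card ≤ m → c + m < k →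
          ¬ (D \ S j).card ≤ c * J := by
        intro m
        induction m with
        | zero =>
          intro j hj c hm
          have : j ∈ U.filter (j ≤ ·) := mem_filter.2 ⟨hj, le_rfl⟩
          rw [Nat.le_zero, card_eq_zero] at hm
          simp [hm] at this
        | succ m ihm =>
          intro j hj c hm hc hle
          obtain ⟨-, -, -, R, hR, hRJ, hRy⟩ := hS j hj
          have hDR : (D \ R).card ≤ (c + 1) * J := by
            have hsub : D \ R ⊆ (D \ S j) ∪ (S j \ R) := by
              intro z; simp only [mem_sdiff, mem_union]; tauto
            have h1 := card_le_card hsub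
            have h2 := card_union_le (D \ S j) (S j \ R)
            rw [add_mul, one_mul]
            omega
          obtain ⟨l, hl, hjl, hRl⟩ :=
            hRy (hbad R hR (hDR.trans (Nat.mul_le_mul_right _ (by omega))))
          refine ihm l hl (c + 1) ?_ (by omega)
            ((card_le_card (sdiff_subset_sdiff Subset.rfl hRl)).trans hDR)
          have hlt : (U.filter (l ≤ ·)).card < (U.filter (j ≤ ·)).card := by
            refine card_lt_card ⟨fun z hz => ?_, fun h => ?_⟩
            · rw [mem_filter] at hz ⊢
              exact ⟨hz.1, hjl.le.trans hz.2⟩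
            · have := mem_filter.1 (h (mem_filter.2 ⟨hj, le_rfl⟩))
              omega
          omega
      have hDS : ∀ j ∈ U, ¬ D ⊆ S j := fun j hj h =>
        hD U.card j hj 0 (card_filter_le _ _) (by omega) (by simp [sdiff_eq_empty_iff_subset.2 h])
      obtain ⟨A, hA, hAmin⟩ := (C.filter fun A => y ∈ A ∧ ∀ j ∈ U, ¬ A ⊆ S j).exists_min_image
        card ⟨D, mem_filter.2 ⟨hDC, hyD, hDS⟩⟩
      obtain ⟨hAC, hyA, hAS⟩ := mem_filter.1 hA
      obtain ⟨R, hRC, hRA, hRJ⟩ := hstep A hAC hyA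
      have hRy : y ∈ R → ∃ j ∈ U, R ⊆ S j := by
        intro hy
        by_contra! hno
        exact absurd (hAmin R (mem_filter.2 ⟨hRC, hy, hno⟩)) (not_le.2 (card_lt_card hRA))
      refine ⟨Function.update S a A, fun i hi => ?_⟩
      have hup : ∀ j ∈ U, Function.update S a A j = S j := fun j hj =>
        Function.update_of_ne (ne_of_mem_of_not_mem hj haU) _ _
      rcases mem_insert.1 hi with rfl | hiU
      · simp only [Function.update_self]
        refine ⟨hCG hAC, hyA, fun j hj hij => ?_, R, hGF _ (hCG hRC), hRJ, fun hy => ?_⟩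
        · have hjU := (mem_insert.1 hj).resolve_left (by omega)
          rw [hup j hjU]
          exact hAS j hjU
        · obtain ⟨j, hj, hRj⟩ := hRy hy
          exact ⟨j, mem_insert_of_mem hj, ha j hj, by rwa [hup j hj]⟩
      · have hai := ha i hiU
        rw [hup i hiU]
        obtain ⟨h1, h2, h3, R, hR, hRJ, hRy⟩ := hS i hiU
        refine ⟨h1, h2, fun j hj hij => ?_, R, hR, hRJ, fun hy => ?_⟩
        · have hjU := (mem_insert.1 hj).resolve_left (by omega)
          rw [hup j hjU]
          exact h3 j hjU hij
        · obtain ⟨j, hj, hij, hRj⟩ := hRy hy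
          exact ⟨j, mem_insert_of_mem hj, hij, by rwa [hup j hj]⟩
  obtain ⟨S, hS⟩ := key T' hT'.le hT
  have hne : ∀ i ∈ T', ∀ j ∈ T', i ≠ j → ¬ S i ⊆ S j := by
    intro i hi j hj hij hsub
    rcases lt_or_gt_of_ne hij with h | h
    · exact (hS i hi).2.2.1 j hj h hsub
    · have h1 := hG j i h _ (hS j hj).1 _ (hS i hi).1
      exact absurd (card_le_card hsub) (not_le.2 h1)
  have hinj : Set.InjOn S T' := by
    intro i hi j hj hij
    by_contra h
    exact hne i hi j hj h hij.subset
  have hlt := hF (T'.image S) (image_subset_iff.2 fun i hi => hGF i (hS i hi).1) (by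
    intro A hA B hB hAB
    obtain ⟨i, hi, rfl⟩ := mem_image.1 hA
    obtain ⟨j, hj, rfl⟩ := mem_image.1 hB
    exact ⟨hne i hi j hj fun h => hAB (h ▸ rfl), y,
      mem_inter.2 ⟨(hS i hi).2.1, (hS j hj).2.1⟩⟩)
  rw [card_image_of_injOn hinj, hT'] at hlt
  exact lt_irrefl _ hlt

/-- The union of the intervals `(p - g, p]` for `p ∈ P`. -/
noncomputable def lowerThickening (P : Finset ℤ) (g : ℕ) : Finset ℤ :=
  P.biUnion fun p => Ioc (p - g) p

/-- The elements `p ∈ P` such that every `r ∈ P` in `(p - L, p]` has a predecessor in `P` at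
distance at most `g`. -/
def descendable (P : Finset ℤ) (g L : ℕ) : Finset ℤ :=
  P.filter fun p => ∀ r ∈ P, p - L < r → r ≤ p → ∃ r' ∈ P, r' < r ∧ r - g ≤ r'

/-- Below each non-descendable element there is a gap, which the thickening at scale `2 * g`
covers at least half more than the thickening at scale `g`. -/
lemma card_lowerThickening_two_mul_le (P : Finset ℤ) (g c : ℕ) :
    (lowerThickening P (2 * g)).card + 2 * (c + 1) * (lowerThickening P g).card ≤
      2 * (c + 1) * (lowerThickening P (2 * g)).card +
        (lowerThickening (descendable P (2 * g) (c * (2 * g))) (2 * g)).card := by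
  set B := P.filter fun r => ∀ r' ∈ P, r' < r → r' < r - (2 * g : ℕ) with hB
  have hsub : lowerThickening P g ⊆ lowerThickening P (2 * g) := by
    intro v
    simp only [lowerThickening, mem_biUnion, mem_Ioc]
    rintro ⟨p, hp, h1, h2⟩
    exact ⟨p, hp, by push_cast; omega, h2⟩
  have hcover : lowerThickening P (2 * g) ⊆
      lowerThickening (descendable P (2 * g) (c * (2 * g))) (2 * g) ∪
        B.biUnion fun r => Ioo (r - (2 * g : ℕ)) (r + (c * (2 * g) : ℕ)) := by
    intro v hv
    simp only [lowerThickening, mem_biUnion, mem_Ioc] at hv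
    obtain ⟨p, hp, h1, h2⟩ := hv
    rw [mem_union]
    by_cases hpd : p ∈ descendable P (2 * g) (c * (2 * g))
    · left
      simp only [lowerThickening, mem_biUnion, mem_Ioc]
      exact ⟨p, hpd, h1, h2⟩
    · right
      simp only [descendable, mem_filter, not_and, not_forall] at hpd
      obtain ⟨r, hr, h3, h4, h5⟩ := hpd hp
      simp only [mem_biUnion, mem_Ioo]
      refine ⟨r, mem_filter.2 ⟨hr, fun r' hr' hlt => ?_⟩, by omega, by omega⟩
      by_contra h
      exact h5 ⟨r', hr', hlt, by omega⟩
  have hgap : B.card * g ≤ (lowerThickening P (2 * g) \ lowerThickening P g).card := by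
    have hdisj : (B : Set ℤ).PairwiseDisjoint fun r => Ioc (r - (2 * g : ℕ)) (r - g) := by
      intro r hr s hs hrs
      have hr := mem_filter.1 hr
      have hs := mem_filter.1 hs
      rw [Function.onFun, disjoint_left]
      intro v hv hv'
      rw [mem_Ioc] at hv hv'
      rcases lt_or_gt_of_ne hrs with h | h
      · have := hs.2 r hr.1 h
        push_cast at *
        omega
      · have := hr.2 s hs.1 h
        push_cast at *
        omega
    have hcard : (B.biUnion fun r => Ioc (r - (2 * g : ℕ)) (r - g)).card = B.card * g := by
      rw [card_biUnion hdisj, sum_const_nat]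
      intro r _
      rw [Int.card_Ioc]
      push_cast
      omega
    rw [← hcard]
    refine card_le_card fun v hv => ?_
    simp only [mem_biUnion, mem_Ioc] at hv
    obtain ⟨r, hr, h1, h2⟩ := hv
    obtain ⟨hrP, hr⟩ := mem_filter.1 hr
    simp only [lowerThickening, mem_sdiff, mem_biUnion, mem_Ioc, not_exists, not_and]
    refine ⟨⟨r, hrP, h1, by omega⟩, fun p hp h3 h4 => ?_⟩
    have := hr p hp (by omega)
    omega
  have h1 := card_le_card hcover
  have h2 := card_union_le (lowerThickening (descendable P (2 * g) (c * (2 * g))) (2 * g))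
    (B.biUnion fun r => Ioo (r - (2 * g : ℕ)) (r + (c * (2 * g) : ℕ)))
  have h3 := card_biUnion_le_card_mul B
    (fun r => Ioo (r - (2 * g : ℕ)) (r + (c * (2 * g) : ℕ))) (2 * (c + 1) * g) (by
      intro r _
      rw [Int.card_Ioo]
      have : 2 * (c + 1) * g = c * (2 * g) + 2 * g := by ring
      rw [this]
      omega)
  have h4 := card_sdiff_add_card_eq_card hsub
  have h5 : B.card * (2 * (c + 1) * g) = 2 * (c + 1) * (B.card * g) := by ring
  have h6 := Nat.mul_le_mul_left (2 * (c + 1)) hgap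
  have h7 : 2 * (c + 1) * (lowerThickening P (2 * g)).card =
      2 * (c + 1) * (lowerThickening P (2 * g) \ lowerThickening P g).card +
        2 * (c + 1) * (lowerThickening P g).card := by
    rw [← h4, mul_add]
  omega

/-- A set of integers with all differences below `m` has at most `m` elements. -/
lemma card_le_of_forall_sub_lt (W : Finset ℤ) (m : ℕ)
    (hW : ∀ v ∈ W, ∀ w ∈ W, v - w < m) : W.card ≤ m := by
  rcases W.eq_empty_or_nonempty with rfl | hne
  · simp
  · have hsub : W ⊆ Ico (W.min' hne) (W.min' hne + m) := fun v hv => by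
      have h1 := W.min'_le v hv
      have h2 := hW v hv _ (W.min'_mem hne)
      rw [mem_Ico]
      omega
    simpa using card_le_card hsub

/-- In a chain of finsets, the thickening of a set `Q` of sizes is controlled by any set `Y`
containing, for each size in `Q`, at least `m` points of `A \ B` for some member `A` of that size
and some member `B` smaller by less than `L + g`. -/
lemma card_lowerThickening_mul_le {α : Type*} [DecidableEq α] {C : Finset (Finset α)}
    (hC : IsChain (· ⊆ ·) (C : Set (Finset α))) (Q : Finset ℤ) (Y : Finset α) {g L m : ℕ}
    (hY : ∀ p ∈ Q, ∃ A ∈ C, ∃ B ∈ C, (A.card : ℤ) = p ∧ A.card < B.card + L + g ∧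
      m ≤ (Y ∩ (A \ B)).card) :
    (lowerThickening Q g).card * m ≤ Y.card * (L + 2 * g) := by
  classical
  let rel : ℤ → α → Prop := fun v y => ∃ A ∈ C, ∃ B ∈ C, A.card < B.card + L + g ∧
    (A.card : ℤ) - g < v ∧ v ≤ A.card ∧ y ∈ A ∧ y ∉ B
  refine card_mul_le_card_mul rel (fun v hv => ?_) (fun y _ => ?_)
  · simp only [lowerThickening, mem_biUnion, mem_Ioc] at hv
    obtain ⟨p, hp, h1, h2⟩ := hv
    obtain ⟨A, hA, B, hB, rfl, hAB, hm⟩ := hY p hp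
    refine hm.trans (card_le_card fun y hy => ?_)
    rw [mem_inter, mem_sdiff] at hy
    exact (mem_bipartiteAbove rel).2 ⟨hy.1, A, hA, B, hB, hAB, h1, h2, hy.2.1, hy.2.2⟩
  · refine card_le_of_forall_sub_lt _ _ fun v hv w hw => ?_
    obtain ⟨-, A, hA, B, hB, h1, h2, h3, h4, h5⟩ := (mem_bipartiteBelow rel).1 hv
    obtain ⟨-, A', hA', B', hB', h1', h2', h3', h4', h5'⟩ := (mem_bipartiteBelow rel).1 hw
    have hBA : B.card ≤ A'.card := by
      rcases hC.total hB hA' with h | h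
      · exact card_le_card h
      · exact absurd (h h4') h5
    push_cast
    omega

/-- For each descendable member `A` of a chain there is a member `B`, not much smaller, such that
at least `k ^ 2 * J` points of `A \ B` are captured. -/
lemma exists_half_captured {α : Type*} [DecidableEq α] {k : ℕ} {F G C : Finset (Finset α)}
    (hF : WeakCrossFree k F) (hk : 2 ≤ k) (hCG : C ⊆ G)
    (hC : IsChain (· ⊆ ·) (C : Set (Finset α))) {J : ℕ} (hJ : 0 < J) {Y : Finset α}
    (hY : ∀ y ∈ C.biUnion id, Captured k F G J y → y ∈ Y) {p : ℤ}
    (hp : p ∈ descendable (C.image fun A => (A.card : ℤ)) J (2 * k ^ 2 * J)) :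
    ∃ A ∈ C, ∃ B ∈ C, (A.card : ℤ) = p ∧ A.card < B.card + 2 * k ^ 2 * J + J ∧
      k ^ 2 * J ≤ (Y ∩ (A \ B)).card := by
  have hsubset : ∀ A ∈ C, ∀ B ∈ C, A.card ≤ B.card → A ⊆ B := fun A hA B hB h => by
    rcases hC.total hA hB with h' | h'
    · exact h'
    · exact (eq_of_subset_of_card_le h' h).symm.subset
  set L := 2 * k ^ 2 * J with hL
  have hLpos : 0 < L := by positivity
  obtain ⟨hpP, hdesc⟩ := mem_filter.1 hp
  obtain ⟨A, hA, rfl⟩ := mem_image.1 hpP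
  have hstep : ∀ S ∈ C, A.card < S.card + L → S.card ≤ A.card →
      ∃ R ∈ C, R.card < S.card ∧ S.card ≤ R.card + J := by
    intro S hS h1 h2
    obtain ⟨r, hr, h3, h4⟩ := hdesc S.card (mem_image_of_mem _ hS) (by omega) (by omega)
    obtain ⟨R, hR, rfl⟩ := mem_image.1 hr
    exact ⟨R, hR, by omega, by omega⟩
  obtain ⟨S₀, hS₀, hS₀min⟩ :=
    (C.filter fun S => A.card < S.card + L ∧ S.card ≤ A.card).exists_min_image
      card ⟨A, mem_filter.2 ⟨hA, by omega, le_rfl⟩⟩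
  obtain ⟨hS₀C, h1, h2⟩ := mem_filter.1 hS₀
  obtain ⟨R₀, hR₀, h3, h4⟩ := hstep S₀ hS₀C h1 h2
  have h5 : R₀.card + L ≤ A.card := by
    by_contra h
    have := hS₀min R₀ (mem_filter.2 ⟨hR₀, by omega, by omega⟩)
    omega
  obtain ⟨B, hB, hBmax⟩ := (C.filter fun S => S.card + L ≤ A.card).exists_max_image card
    ⟨R₀, mem_filter.2 ⟨hR₀, h5⟩⟩
  obtain ⟨hBC, hBA⟩ := mem_filter.1 hB
  have h6 := hBmax R₀ (mem_filter.2 ⟨hR₀, h5⟩)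
  refine ⟨A, hA, B, hBC, rfl, by omega, ?_⟩
  set N := (F.filter fun S => (A \ S).card ≤ k * J).biUnion fun S => A \ S with hN
  have hkk : 2 * (k * J) ≤ k ^ 2 * J := by
    have : 2 * (k * J) = 2 * k * J := by ring
    rw [this]
    exact Nat.mul_le_mul_right _ (by nlinarith)
  have hkJ : 0 < k * J := by positivity
  have hLL : L = 2 * (k ^ 2 * J) := by rw [hL]; ring
  have hNcard : N.card ≤ (k - 1) * (k * J) := hF.card_biUnion_sdiff_le A (by omega)
  have hNcard' : N.card ≤ k ^ 2 * J :=
    hNcard.trans ((Nat.mul_le_mul_right _ (Nat.sub_le k 1)).trans (le_of_eq (by ring)))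
  have hsub : (A \ B) \ N ⊆ Y ∩ (A \ B) := by
    intro y hy
    obtain ⟨hyAB, hyN⟩ := mem_sdiff.1 hy
    obtain ⟨hyA, hyB⟩ := mem_sdiff.1 hyAB
    refine mem_inter.2 ⟨hY y (mem_biUnion.2 ⟨A, hA, hyA⟩) ?_, hyAB⟩
    refine ⟨C.filter fun S => S.card ≤ A.card, (filter_subset _ _).trans hCG, A,
      mem_filter.2 ⟨hA, le_rfl⟩, hyA, fun S hS hyS => ?_, fun S hS hSA => ?_⟩
    · obtain ⟨hSC, hSA⟩ := mem_filter.1 hS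
      have h7 : A.card < S.card + L := by
        by_contra h
        exact hyB (hsubset S hSC B hBC (hBmax S (mem_filter.2 ⟨hSC, by omega⟩)) hyS)
      obtain ⟨R, hR, h8, h9⟩ := hstep S hSC h7 hSA
      have hRS := hsubset R hR S hSC h8.le
      refine ⟨R, mem_filter.2 ⟨hR, by omega⟩, hRS.ssubset_of_ne fun h => ?_, ?_⟩
      · rw [h] at h8
        exact lt_irrefl _ h8
      · rw [card_sdiff_of_subset hRS]
        omega
    · by_contra hyS
      exact hyN (mem_biUnion.2 ⟨S, mem_filter.2 ⟨hS, hSA⟩, mem_sdiff.2 ⟨hyA, hyS⟩⟩)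
  have h7 := card_le_card hsub
  have h8 := le_card_sdiff N (A \ B)
  have h9 := card_sdiff_of_subset (hsubset B hBC A hA (by omega))
  omega

/-- The contraction ratio between thickenings at consecutive dyadic scales. -/
noncomputable def ratio (k : ℕ) : ℝ := 1 - 1 / (2 * (2 * k ^ 2 + 1))

lemma ratio_nonneg (k : ℕ) : 0 ≤ ratio k := by
  have : (1 : ℝ) / (2 * (2 * k ^ 2 + 1)) ≤ 1 := by
    rw [div_le_one (by positivity)]
    nlinarith [sq_nonneg (k : ℝ)]
  unfold ratio
  linarith

lemma sum_ratio_pow_le (k N : ℕ) :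
    ∑ q ∈ range N, ratio k ^ q ≤ 2 * (2 * k ^ 2 + 1) := by
  have h : ∑ q ∈ range N, ratio k ^ q =
      2 * (2 * k ^ 2 + 1) - 2 * (2 * k ^ 2 + 1) * ratio k ^ N := by
    induction N with
    | zero => simp
    | succ N ih =>
      rw [sum_range_succ, ih, pow_succ]
      have : (2 * (2 * (k : ℝ) ^ 2 + 1)) * ratio k = 2 * (2 * k ^ 2 + 1) - 1 := by
        unfold ratio
        field_simp
      linear_combination ratio k ^ N * this
  rw [h]
  have := pow_nonneg (ratio_nonneg k) N
  nlinarith [sq_nonneg (k : ℝ)]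

/-- A chain of sets of sizes in `[2 ^ i, 2 ^ (i + 1))` is short, up to captured points. -/
lemma card_chain_le {α : Type*} [DecidableEq α] {k : ℕ} {F G C : Finset (Finset α)}
    (hF : WeakCrossFree k F) (hk : 2 ≤ k) (hCG : C ⊆ G)
    (hC : IsChain (· ⊆ ·) (C : Set (Finset α))) {i : ℕ}
    (hi : ∀ A ∈ C, 2 ^ i ≤ A.card ∧ A.card < 2 ^ (i + 1)) (Y : ℕ → Finset α)
    (hY : ∀ q, ∀ y ∈ C.biUnion id, Captured k F G (2 ^ q) y → y ∈ Y q) :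
    (C.card : ℝ) ≤ ∑ q ∈ range i, ratio k ^ q * (3 * (Y (q + 1)).card) +
      ratio k ^ i * 2 ^ (i + 1) := by
  set P := C.image fun A => (A.card : ℤ) with hP
  set u : ℕ → ℝ := fun q => (lowerThickening P (2 ^ q)).card with hu
  have hrec : ∀ q, u q ≤ ratio k * u (q + 1) + 3 * (Y (q + 1)).card := by
    intro q
    have h1 := card_lowerThickening_two_mul_le P (2 ^ q) (2 * k ^ 2)
    rw [← pow_succ'] at h1
    have h2 := card_lowerThickening_mul_le hC
      (descendable P (2 ^ (q + 1)) (2 * k ^ 2 * 2 ^ (q + 1))) (Y (q + 1))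
      (fun p hp => exists_half_captured hF hk hCG hC (by positivity) (hY (q + 1)) hp)
    have h3 : (lowerThickening (descendable P (2 ^ (q + 1)) (2 * k ^ 2 * 2 ^ (q + 1)))
        (2 ^ (q + 1))).card ≤ 3 * (Y (q + 1)).card := by
      have hpos : 0 < k ^ 2 * 2 ^ (q + 1) := by positivity
      refine Nat.le_of_mul_le_mul_right (h2.trans ?_) hpos
      have : 2 * k ^ 2 * 2 ^ (q + 1) + 2 * 2 ^ (q + 1) ≤ 3 * (k ^ 2 * 2 ^ (q + 1)) := by
        have : 2 * 2 ^ (q + 1) ≤ k ^ 2 * 2 ^ (q + 1) := Nat.mul_le_mul_right _ (by nlinarith)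
        linarith
      calc _ ≤ (Y (q + 1)).card * (3 * (k ^ 2 * 2 ^ (q + 1))) := Nat.mul_le_mul_left _ this
        _ = _ := by ring
    have h4 : u (q + 1) + 2 * (2 * k ^ 2 + 1) * u q ≤
        2 * (2 * k ^ 2 + 1) * u (q + 1) + 3 * (Y (q + 1)).card := by
      have h5 := h1.trans (Nat.add_le_add_left h3 _)
      simp only [hu]
      exact_mod_cast h5
    have hK : (1 : ℝ) ≤ 2 * (2 * k ^ 2 + 1) := by nlinarith [sq_nonneg (k : ℝ)]
    have h6 : 2 * (2 * (k : ℝ) ^ 2 + 1) * ratio k = 2 * (2 * k ^ 2 + 1) - 1 := by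
      unfold ratio
      field_simp
    have h7 : (0 : ℝ) ≤ 3 * (Y (q + 1)).card := by positivity
    refine le_of_mul_le_mul_left ?_ (lt_of_lt_of_le one_pos hK)
    have h8 : 2 * (2 * (k : ℝ) ^ 2 + 1) * (ratio k * u (q + 1) + 3 * (Y (q + 1)).card) =
        (2 * (2 * k ^ 2 + 1) - 1) * u (q + 1) +
          2 * (2 * k ^ 2 + 1) * (3 * (Y (q + 1)).card) := by
      rw [← h6]
      ring
    have h9 := mul_le_mul_of_nonneg_right hK h7
    linarith
  have hiter : ∀ n, u 0 ≤ ∑ q ∈ range n, ratio k ^ q * (3 * (Y (q + 1)).card) +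
      ratio k ^ n * u n := by
    intro n
    induction n with
    | zero => simp
    | succ n ih =>
      have := mul_le_mul_of_nonneg_left (hrec n) (pow_nonneg (ratio_nonneg k) n)
      rw [sum_range_succ, pow_succ]
      linarith
  have h0 : (C.card : ℝ) ≤ u 0 := by
    have hinj : Set.InjOn (fun A : Finset α => (A.card : ℤ)) C := by
      intro A hA B hB hAB
      have hAB : A.card = B.card := Int.ofNat.inj hAB
      rcases hC.total hA hB with h | h
      · exact eq_of_subset_of_card_le h hAB.ge
      · exact (eq_of_subset_of_card_le h hAB.le).symm
    have hsub : P ⊆ lowerThickening P (2 ^ 0) := fun p hp =>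
      mem_biUnion.2 ⟨p, hp, mem_Ioc.2 ⟨by simp, le_rfl⟩⟩
    have := card_le_card hsub
    rw [hP, card_image_of_injOn hinj, ← hP] at this
    simp only [hu]
    exact_mod_cast this
  have htop : u i ≤ 2 ^ (i + 1) := by
    have hsub : lowerThickening P (2 ^ i) ⊆ Ioc (0 : ℤ) (2 ^ (i + 1) : ℕ) := by
      intro v hv
      simp only [lowerThickening, mem_biUnion, mem_Ioc] at hv
      obtain ⟨p, hp, h1, h2⟩ := hv
      obtain ⟨A, hA, rfl⟩ := mem_image.1 hp
      obtain ⟨h3, h4⟩ := hi A hA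
      rw [mem_Ioc]
      omega
    have := card_le_card hsub
    rw [Int.card_Ioc, sub_zero, Int.toNat_natCast] at this
    simp only [hu]
    exact_mod_cast this
  have := mul_le_mul_of_nonneg_left htop (pow_nonneg (ratio_nonneg k) i)
  linarith [hiter i]

/-- A weakly cross-free family of sets of sizes in `[2 ^ i, 2 ^ (i + 1))` is small, up to the
number of captured points at each scale. -/
lemma WeakCrossFree.card_le_of_dyadic {α : Type*} [DecidableEq α] {k : ℕ}
    {F G : Finset (Finset α)} (hF : WeakCrossFree k F) (hk : 2 ≤ k) (hGF : G ⊆ F) {i : ℕ}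
    (hi : ∀ A ∈ G, 2 ^ i ≤ A.card ∧ A.card < 2 ^ (i + 1)) {X : Finset α}
    (hX : ∀ A ∈ G, A ⊆ X) (Z : ℕ → Finset α)
    (hZ : ∀ q, ∀ y ∈ X, Captured k F G (2 ^ q) y → y ∈ Z q) :
    (G.card : ℝ) ≤ 6 * ((k - 1 : ℕ) : ℝ) ^ 2 * ∑ q ∈ range i, ratio k ^ q * (Z (q + 1)).card +
      2 * ((k - 1 : ℕ) : ℝ) * (ratio k ^ i * X.card) := by
  set m : ℝ := ((k - 1 : ℕ) : ℝ) with hm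
  have hm0 : 0 ≤ m := by positivity
  set W : α → ℕ → Finset α := fun x q => (Z q).filter fun y => ∃ D ∈ G, x ∈ D ∧ y ∈ D with hW
  have hpoint : ∀ x ∈ X, ((G.filter fun A => x ∈ A).card : ℝ) ≤
      m * (∑ q ∈ range i, ratio k ^ q * (3 * (W x (q + 1)).card) +
        ratio k ^ i * 2 ^ (i + 1)) := by
    intro x _
    obtain ⟨C, hCG, hC, hcard⟩ := hF.exists_chain x (G.filter fun A => x ∈ A)
      ((filter_subset _ _).trans hGF) fun A hA => (mem_filter.1 hA).2
    have hCG' : C ⊆ G := hCG.trans (filter_subset _ _)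
    have h := card_chain_le hF hk hCG' hC (fun A hA => hi A (hCG' hA)) (W x) (by
      intro q y hy hcap
      obtain ⟨D, hD, hyD⟩ := mem_biUnion.1 hy
      exact mem_filter.2 ⟨hZ q y (hX D (hCG' hD) hyD) hcap, D, hCG' hD,
        (mem_filter.1 (hCG hD)).2, hyD⟩)
    calc ((G.filter fun A => x ∈ A).card : ℝ) ≤ m * C.card := by
          rw [hm]
          exact_mod_cast hcard
      _ ≤ _ := mul_le_mul_of_nonneg_left h hm0
  have hswap : ∀ q, (∑ x ∈ X, ((W x q).card : ℝ)) ≤ (Z q).card * (m * 2 ^ (i + 1)) := by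
    intro q
    have h : ∑ x ∈ X, (W x q).card = ∑ y ∈ Z q, (X.filter fun x => ∃ D ∈ G, x ∈ D ∧ y ∈ D).card :=
      sum_card_bipartiteAbove_eq_sum_card_bipartiteBelow fun x y => ∃ D ∈ G, x ∈ D ∧ y ∈ D
    have h' : ∑ x ∈ X, (W x q).card ≤ (Z q).card * ((k - 1) * 2 ^ (i + 1)) := by
      rw [h, ← smul_eq_mul]
      refine sum_le_card_nsmul _ _ _ fun y _ => ?_
      refine le_trans (card_le_card fun x hx => ?_) (hF.card_biUnion_le
        (G := G.filter fun A => y ∈ A) ((filter_subset _ _).trans hGF) (x := y)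
        (fun A hA => (mem_filter.1 hA).2) fun A hA => (hi A (mem_filter.1 hA).1).2.le)
      obtain ⟨D, hD, hxD, hyD⟩ := (mem_filter.1 hx).2
      exact mem_biUnion.2 ⟨D, mem_filter.2 ⟨hD, hyD⟩, hxD⟩
    rw [hm]
    exact_mod_cast h'
  have hcount : (2 : ℝ) ^ i * G.card ≤ ∑ x ∈ X, ((G.filter fun A => x ∈ A).card : ℝ) := by
    have h : ∑ A ∈ G, (X.filter fun x => x ∈ A).card = ∑ x ∈ X, (G.filter fun A => x ∈ A).card :=
      sum_card_bipartiteAbove_eq_sum_card_bipartiteBelow fun A x => x ∈ A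
    have h' : G.card * 2 ^ i ≤ ∑ A ∈ G, (X.filter fun x => x ∈ A).card := by
      rw [← smul_eq_mul]
      refine card_nsmul_le_sum _ _ _ fun A hA => (hi A hA).1.trans (card_le_card fun x hx => ?_)
      exact mem_filter.2 ⟨hX A hA hx, hx⟩
    rw [h, mul_comm] at h'
    exact_mod_cast h'
  have hpos : (0 : ℝ) < 2 ^ i := by positivity
  refine le_of_mul_le_mul_left ?_ hpos
  calc (2 : ℝ) ^ i * G.card ≤ ∑ x ∈ X, m * (∑ q ∈ range i,
        ratio k ^ q * (3 * (W x (q + 1)).card) + ratio k ^ i * 2 ^ (i + 1)) :=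
        hcount.trans (sum_le_sum hpoint)
    _ = m * (∑ q ∈ range i, 3 * ratio k ^ q * ∑ x ∈ X, ((W x (q + 1)).card : ℝ)) +
        m * (X.card * (ratio k ^ i * 2 ^ (i + 1))) := by
        rw [← mul_sum, sum_add_distrib, sum_comm, sum_const, nsmul_eq_mul, mul_add]
        congr 2
        refine sum_congr rfl fun q _ => ?_
        rw [mul_sum]
        exact sum_congr rfl fun x _ => by ring
    _ ≤ m * (∑ q ∈ range i, 3 * ratio k ^ q * ((Z (q + 1)).card * (m * 2 ^ (i + 1)))) +
        m * (X.card * (ratio k ^ i * 2 ^ (i + 1))) := by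
        gcongr with q _
        · exact mul_nonneg (by norm_num) (pow_nonneg (ratio_nonneg k) q)
        · exact hswap (q + 1)
    _ = _ := by
        have : ∑ q ∈ range i, 3 * ratio k ^ q * ((Z (q + 1)).card * (m * 2 ^ (i + 1))) =
            (3 * (m * 2 ^ (i + 1))) * ∑ q ∈ range i, ratio k ^ q * (Z (q + 1)).card := by
          rw [mul_sum]
          exact sum_congr rfl fun q _ => by ring
        rw [this, pow_succ]
        ring

/-- A weakly cross-free family of nonempty sets has linear size. -/
theorem WeakCrossFree.card_le {α : Type*} [DecidableEq α] {k : ℕ}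
    {F : Finset (Finset α)} (hF : WeakCrossFree k F) (hk : 2 ≤ k) {X : Finset α}
    (hX : ∀ A ∈ F, A ⊆ X) (hne : ∀ A ∈ F, A.Nonempty) :
    (F.card : ℝ) ≤ (6 * ((k - 1 : ℕ) : ℝ) ^ 3 + 2 * ((k - 1 : ℕ) : ℝ)) *
      (2 * (2 * k ^ 2 + 1)) * X.card := by
  classical
  set m : ℝ := ((k - 1 : ℕ) : ℝ) with hm
  have hm0 : 0 ≤ m := by positivity
  set G : ℕ → Finset (Finset α) := fun i => F.filter fun A => Nat.log 2 A.card = i with hG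
  set Z : ℕ → ℕ → Finset α := fun i q => X.filter fun y => Captured k F (G i) (2 ^ q) y with hZ
  set N := X.card + 1 with hN
  have hGF : ∀ i, G i ⊆ F := fun i => filter_subset _ _
  have hdyadic : ∀ i, ∀ A ∈ G i, 2 ^ i ≤ A.card ∧ A.card < 2 ^ (i + 1) := by
    intro i A hA
    obtain ⟨hAF, rfl⟩ := mem_filter.1 hA
    exact ⟨Nat.pow_log_le_self 2 (hne A hAF).card_pos.ne', Nat.lt_pow_succ_log_self one_lt_two _⟩
  have hsep : ∀ i j, i < j → ∀ A ∈ G i, ∀ B ∈ G j, A.card < B.card := fun i j hij A hA B hB =>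
    (hdyadic i A hA).2.trans_le
      ((Nat.pow_le_pow_right two_pos hij).trans (hdyadic j B hB).1)
  have hscale : ∀ i ∈ range N, ((G i).card : ℝ) ≤
      6 * m ^ 2 * ∑ q ∈ range N, ratio k ^ q * (Z i (q + 1)).card +
        2 * m * (ratio k ^ i * X.card) := by
    intro i hi
    have h := hF.card_le_of_dyadic hk (hGF i) (hdyadic i) (fun A hA => hX A (hGF i hA)) (Z i)
      fun q y hy hcap => mem_filter.2 ⟨hy, hcap⟩
    refine h.trans ?_
    refine add_le_add_left (mul_le_mul_of_nonneg_left ?_ (by positivity)) _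
    refine sum_le_sum_of_subset_of_nonneg (range_mono (mem_range.1 hi).le) fun q _ _ => ?_
    exact mul_nonneg (pow_nonneg (ratio_nonneg k) q) (by positivity)
  have hcaptured : ∀ q, ∑ i ∈ range N, ((Z i q).card : ℝ) ≤ m * X.card := by
    intro q
    have h : ∑ i ∈ range N, (Z i q).card =
        ∑ y ∈ X, ((range N).filter fun i => Captured k F (G i) (2 ^ q) y).card :=
      sum_card_bipartiteAbove_eq_sum_card_bipartiteBelow fun i y => Captured k F (G i) (2 ^ q) y
    have h' : ∑ i ∈ range N, (Z i q).card ≤ X.card * (k - 1) := by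
      rw [h, ← smul_eq_mul]
      refine sum_le_card_nsmul _ _ _ fun y _ => ?_
      have := hF.card_captured_lt G hGF hsep
        ((range N).filter fun i => Captured k F (G i) (2 ^ q) y) fun i hi => (mem_filter.1 hi).2
      omega
    rw [mul_comm] at h'
    rw [hm]
    exact_mod_cast h'
  have hcard : F.card = ∑ i ∈ range N, (G i).card := by
    refine card_eq_sum_card_fiberwise fun A hA => ?_
    have h1 := card_le_card (hX A hA)
    have h2 := Nat.log_le_self 2 A.card
    simp only [coe_range, Set.mem_Iio]
    omega
  rw [hcard]
  push_cast
  have hsum := sum_ratio_pow_le k N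
  calc ∑ i ∈ range N, ((G i).card : ℝ) ≤ ∑ i ∈ range N,
        (6 * m ^ 2 * ∑ q ∈ range N, ratio k ^ q * (Z i (q + 1)).card +
          2 * m * (ratio k ^ i * X.card)) := sum_le_sum hscale
    _ = 6 * m ^ 2 * ∑ q ∈ range N, ratio k ^ q * ∑ i ∈ range N, ((Z i (q + 1)).card : ℝ) +
          2 * m * ((∑ i ∈ range N, ratio k ^ i) * X.card) := by
        rw [sum_add_distrib, ← mul_sum, ← mul_sum, sum_comm, sum_mul]
        simp only [mul_sum]
    _ ≤ 6 * m ^ 2 * ∑ q ∈ range N, ratio k ^ q * (m * X.card) +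
          2 * m * ((∑ i ∈ range N, ratio k ^ i) * X.card) := by
        gcongr with q _
        · exact pow_nonneg (ratio_nonneg k) q
        · exact hcaptured (q + 1)
    _ = (6 * m ^ 3 + 2 * m) * (∑ i ∈ range N, ratio k ^ i) * X.card := by
        rw [← sum_mul]
        ring
    _ ≤ _ := by gcongr

/-- Sets missing a point `x₀` of the ground set cross as soon as they intersect and are
incomparable. -/
lemma crossing_of_not_subset {α : Type*} [DecidableEq α] {X A B : Finset α} {x₀ : α}
    (hx₀ : x₀ ∈ X) (hA : x₀ ∉ A) (hB : x₀ ∉ B) (hAB : ¬ A ⊆ B) (hBA : ¬ B ⊆ A)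
    (hne : (A ∩ B).Nonempty) : Crossing X A B :=
  ⟨sdiff_nonempty.2 hAB, sdiff_nonempty.2 hBA, hne, x₀, by simp [hx₀, hA, hB]⟩

/-- Sets with crossing complements are crossing. -/
lemma Crossing.of_sdiff {α : Type*} [DecidableEq α] {X A B : Finset α}
    (h : Crossing X (X \ A) (X \ B)) : Crossing X A B := by
  obtain ⟨⟨a, ha⟩, ⟨b, hb⟩, ⟨c, hc⟩, d, hd⟩ := h
  simp only [mem_sdiff, mem_inter, mem_union] at ha hb hc hd
  refine ⟨⟨b, ?_⟩, ⟨a, ?_⟩, ⟨d, ?_⟩, c, ?_⟩ <;>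
    simp only [mem_sdiff, mem_inter, mem_union] <;> tauto

lemma CrossFreeFam.mono {α : Type*} [DecidableEq α] {k : ℕ} {X : Finset α}
    {F G : Finset (Finset α)} (hF : CrossFreeFam k X F) (hGF : G ⊆ F) : CrossFreeFam k X G :=
  fun ⟨S, hS, h⟩ => hF ⟨S, hS.trans hGF, h⟩

/-- The complements of the members of a cross-free family form a cross-free family. -/
lemma CrossFreeFam.image_sdiff {α : Type*} [DecidableEq α] {k : ℕ} {X : Finset α}
    {F : Finset (Finset α)} (hF : CrossFreeFam k X F) (hX : ∀ A ∈ F, A ⊆ X) :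
    CrossFreeFam k X (F.image fun A => X \ A) := by
  rintro ⟨S, hS, hcard, hcross⟩
  have hcompl : ∀ A ∈ S, X \ A ∈ F ∧ X \ (X \ A) = A := by
    intro A hA
    obtain ⟨B, hB, rfl⟩ := mem_image.1 (hS hA)
    rw [Finset.sdiff_sdiff_eq_self (hX B hB)]
    exact ⟨hB, rfl⟩
  refine hF ⟨S.image fun A => X \ A, image_subset_iff.2 fun A hA => (hcompl A hA).1, ?_, ?_⟩
  · rw [card_image_of_injOn fun A hA B hB hAB => ?_, hcard]
    rw [← (hcompl A hA).2, ← (hcompl B hB).2]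
    exact congrArg (X \ ·) hAB
  · rintro _ hA' _ hB' hAB
    obtain ⟨A, hA, rfl⟩ := mem_image.1 (mem_coe.1 hA')
    obtain ⟨B, hB, rfl⟩ := mem_image.1 (mem_coe.1 hB')
    refine Crossing.of_sdiff ?_
    rw [(hcompl A hA).2, (hcompl B hB).2]
    exact hcross hA hB fun h => hAB (by rw [h])

/-- A cross-free family of sets missing a common point of the ground set has linear size. -/
lemma CrossFreeFam.card_le_of_notMem {α : Type*} [DecidableEq α] {k : ℕ} {X : Finset α}
    {F : Finset (Finset α)} (hF : CrossFreeFam k X F) (hk : 2 ≤ k) (hX : ∀ A ∈ F, A ⊆ X) {x₀ : α}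
    (hx₀ : x₀ ∈ X) (hFx₀ : ∀ A ∈ F, x₀ ∉ A) :
    (F.card : ℝ) ≤ ((6 * ((k - 1 : ℕ) : ℝ) ^ 3 + 2 * ((k - 1 : ℕ) : ℝ)) *
      (2 * (2 * k ^ 2 + 1)) + 1) * X.card := by
  have hweak : WeakCrossFree k (F.erase ∅) := by
    intro S hS hSp
    by_contra! hcard
    obtain ⟨T, hTS, hT⟩ := exists_subset_card_eq hcard
    have hTF : T ⊆ F := hTS.trans (hS.trans (erase_subset _ _))
    refine hF ⟨T, hTF, hT, fun A hA B hB hAB => ?_⟩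
    exact crossing_of_not_subset hx₀ (hFx₀ A (hTF hA)) (hFx₀ B (hTF hB))
      (hSp A (hTS hA) B (hTS hB) hAB).1 (hSp B (hTS hB) A (hTS hA) hAB.symm).1
      (hSp A (hTS hA) B (hTS hB) hAB).2
  have h := hweak.card_le hk (X := X) (fun A hA => hX A (mem_of_mem_erase hA))
    fun A hA => nonempty_iff_ne_empty.2 (ne_of_mem_erase hA)
  have h1 : (F.card : ℝ) ≤ (F.erase ∅).card + 1 := by
    exact_mod_cast Nat.sub_le_iff_le_add.1 (pred_card_le_card_erase (s := F) (a := ∅))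
  have h2 : (1 : ℝ) ≤ X.card := by
    exact_mod_cast card_pos.2 ⟨x₀, hx₀⟩
  linarith

theorem karzanov_lomonosov (k : ℕ) (hk : 2 ≤ k) :
    ∃ c : ℝ, 0 < c ∧
      ∀ (α : Type) [DecidableEq α] (X : Finset α) (F : Finset (Finset α)),
        1 ≤ X.card → (∀ A ∈ F, A ⊆ X) → CrossFreeFam k X F →
        (F.card : ℝ) ≤ c * X.card := by
  refine ⟨2 * ((6 * ((k - 1 : ℕ) : ℝ) ^ 3 + 2 * ((k - 1 : ℕ) : ℝ)) *
    (2 * (2 * k ^ 2 + 1)) + 1), by positivity, fun α _ X F hX hFX hF => ?_⟩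
  obtain ⟨x₀, hx₀⟩ := card_pos.1 hX
  have h1 := (hF.mono (filter_subset (x₀ ∉ ·) F)).card_le_of_notMem hk
    (fun A hA => hFX A (mem_filter.1 hA).1) hx₀ fun A hA => (mem_filter.1 hA).2
  have hmem : ∀ A ∈ F.filter (x₀ ∈ ·), A ⊆ X := fun A hA => hFX A (mem_filter.1 hA).1
  have h2 := ((hF.mono (filter_subset (x₀ ∈ ·) F)).image_sdiff hmem).card_le_of_notMem hk
    (x₀ := x₀) (by simp only [forall_mem_image, sdiff_subset, implies_true]) hx₀ (by
      intro A hA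
      obtain ⟨B, hB, rfl⟩ := mem_image.1 hA
      simp [(mem_filter.1 hB).2])
  rw [card_image_of_injOn fun A hA B hB hAB => ?_] at h2
  · have h3 : ((F.filter (x₀ ∈ ·)).card : ℝ) + (F.filter (x₀ ∉ ·)).card = F.card := by
      exact_mod_cast card_filter_add_card_filter_not (s := F) (x₀ ∈ ·)
    linarith
  · rw [← Finset.sdiff_sdiff_eq_self (hmem A hA), ← Finset.sdiff_sdiff_eq_self (hmem B hB)]
    exact congrArg (X \ ·) hAB
end

section
/- For every integer k ≥ 2 there exists a constant c_k > 0 such that the following holds: if X is a finite set of size n ≥ 1 and F ⊆ 2^X is a weakly-k-cross-free family of subsets of X, then |F| ≤ c_k · n. -/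
open Finset

/-- Two subsets `A` and `B` are weakly-crossing if none of the three sets
`A ∩ B`, `A \ B`, `B \ A` is empty. -/
def WeaklyCrossing {α : Type*} [DecidableEq α] (A B : Finset α) : Prop :=
  (A ∩ B).Nonempty ∧ (A \ B).Nonempty ∧ (B \ A).Nonempty

/-- A family is weakly-`k`-cross-free if it contains no `k` members that are
pairwise weakly-crossing. -/
def WeaklyCrossFreeFam {α : Type*} [DecidableEq α] (k : ℕ)
    (F : Finset (Finset α)) : Prop :=
  ¬ ∃ S : Finset (Finset α), S ⊆ F ∧ S.card = k ∧
      (S : Set (Finset α)).Pairwise WeaklyCrossing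

section CrossFree

variable {α : Type*}

/-- A strictly descending chain `g 0 ⊃ g 1 ⊃ ⋯ ⊃ g c` of members of `G`. -/
def IsDescChain (G : Finset (Finset α)) (c : ℕ) (g : ℕ → Finset α) : Prop :=
  (∀ i ≤ c, g i ∈ G) ∧ ∀ i < c, g (i + 1) ⊂ g i

theorem IsDescChain.subset {G : Finset (Finset α)} {c : ℕ} {g : ℕ → Finset α}
    (h : IsDescChain G c g) {i j : ℕ} (hij : i ≤ j) (hj : j ≤ c) : g j ⊆ g i := by
  induction j, hij using Nat.le_induction with
  | base => exact Subset.rfl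
  | succ j _ ih => exact (h.2 j (by omega)).1.trans (ih (by omega))

theorem IsDescChain.mono {F G : Finset (Finset α)} {c : ℕ} {g : ℕ → Finset α}
    (h : IsDescChain G c g) (hGF : G ⊆ F) : IsDescChain F c g :=
  ⟨fun i hi => hGF (h.1 i hi), h.2⟩

variable [DecidableEq α]

theorem WeaklyCrossing.symm {A B : Finset α} (h : WeaklyCrossing A B) : WeaklyCrossing B A :=
  ⟨by rw [inter_comm]; exact h.1, h.2.2, h.2.1⟩

theorem weaklyCrossing_of_not_subset {A B : Finset α} {z : α} (hA : z ∈ A) (hB : z ∈ B)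
    (hAB : ¬ A ⊆ B) (hBA : ¬ B ⊆ A) : WeaklyCrossing A B :=
  ⟨⟨z, mem_inter.2 ⟨hA, hB⟩⟩, sdiff_nonempty.2 hAB, sdiff_nonempty.2 hBA⟩

theorem WeaklyCrossing.of_inter {A B Y : Finset α} (h : WeaklyCrossing (A ∩ Y) (B ∩ Y)) :
    WeaklyCrossing A B := by
  obtain ⟨⟨a, ha⟩, ⟨b, hb⟩, ⟨c, hc⟩⟩ := h
  simp only [mem_inter, mem_sdiff] at ha hb hc
  exact ⟨⟨a, by simp; tauto⟩, ⟨b, by simp; tauto⟩, ⟨c, by simp; tauto⟩⟩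

/-- A weakly-`k`-cross-free family has no indexed family of at least `k` pairwise weakly-crossing
members. -/
theorem WeaklyCrossFreeFam.card_lt_of_pairwise {k : ℕ} {F : Finset (Finset α)}
    (hF : WeaklyCrossFreeFam k F) {ι : Type*} (s : Finset ι) (h : ι → Finset α)
    (hmem : ∀ i ∈ s, h i ∈ F)
    (hpair : ∀ i ∈ s, ∀ j ∈ s, i ≠ j → WeaklyCrossing (h i) (h j)) : s.card < k := by
  by_contra! hk
  obtain ⟨t, hts, htk⟩ := exists_subset_card_eq hk
  have hinj : Set.InjOn h t := by
    intro i hi j hj hij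
    by_contra hne
    have := (hpair i (hts hi) j (hts hj) hne).2.1
    simp [hij] at this
  refine hF ⟨t.image h, ?_, ?_, ?_⟩
  · intro A hA
    obtain ⟨i, hi, rfl⟩ := mem_image.1 hA
    exact hmem i (hts hi)
  · rw [card_image_of_injOn hinj, htk]
  · intro A hA B hB hAB
    obtain ⟨i, hi, rfl⟩ := mem_image.1 (mem_coe.1 hA)
    obtain ⟨j, hj, rfl⟩ := mem_image.1 (mem_coe.1 hB)
    exact hpair i (hts hi) j (hts hj) (fun e => hAB (by rw [e]))

theorem WeaklyCrossFreeFam.card_lt_of_antichain {k : ℕ} {F G : Finset (Finset α)}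
    (hF : WeaklyCrossFreeFam k F) (hG : G ⊆ F) (z : α) (hz : ∀ A ∈ G, z ∈ A)
    (hanti : ∀ A ∈ G, ∀ B ∈ G, A ⊆ B → A = B) : G.card < k :=
  hF.card_lt_of_pairwise G id (fun _ hA => hG hA) fun A hA B hB hne =>
    weaklyCrossing_of_not_subset (hz A hA) (hz B hB) (fun h => hne (hanti A hA B hB h))
      fun h => hne (hanti B hB A hA h).symm

theorem WeaklyCrossFreeFam.mono {k : ℕ} {F G : Finset (Finset α)}
    (hF : WeaklyCrossFreeFam k F) (hG : G ⊆ F) : WeaklyCrossFreeFam k G :=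
  fun ⟨S, hS, h⟩ => hF ⟨S, hS.trans hG, h⟩

theorem WeaklyCrossFreeFam.trace {k : ℕ} {F : Finset (Finset α)}
    (hF : WeaklyCrossFreeFam k F) (Y : Finset α) :
    WeaklyCrossFreeFam k ((F.image (· ∩ Y)).erase ∅) := by
  rintro ⟨S, hS, hk, hp⟩
  have hpre : ∀ A ∈ S, ∃ B ∈ F, B ∩ Y = A := fun A hA =>
    mem_image.1 (mem_of_mem_erase (hS hA))
  choose! h hhF hh using hpre
  refine absurd (hF.card_lt_of_pairwise S h hhF ?_) (by omega)
  intro A hA B hB hne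
  have := hp (mem_coe.2 hA) (mem_coe.2 hB) hne
  rw [← hh A hA, ← hh B hB] at this
  exact this.of_inter

/-- Few members of a weakly-cross-free family are small. -/
theorem WeaklyCrossFreeFam.card_small_le {k : ℕ} {F : Finset (Finset α)} {X : Finset α}
    (hF : WeaklyCrossFreeFam k F) (hX : ∀ A ∈ F, A ⊆ X) (hne : ∀ A ∈ F, A.Nonempty) (q : ℕ) :
    (F.filter fun A => A.card < q).card ≤ X.card * (q * k) := by
  have hsub : (F.filter fun A => A.card < q) ⊆
      X.biUnion fun a => (range q).biUnion fun s => F.filter fun A => a ∈ A ∧ A.card = s := by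
    intro A hA
    obtain ⟨hAF, hAq⟩ := mem_filter.1 hA
    obtain ⟨a, ha⟩ := hne A hAF
    simp only [mem_biUnion, mem_filter, mem_range]
    exact ⟨a, hX A hAF ha, A.card, hAq, hAF, ha, rfl⟩
  refine (card_le_card hsub).trans (card_biUnion_le_card_mul _ _ _ fun a _ => ?_)
  refine (card_biUnion_le_card_mul _ _ k fun s _ => ?_).trans (by rw [card_range])
  refine (hF.card_lt_of_antichain (filter_subset _ _) a (fun A hA => (mem_filter.1 hA).2.1)
    fun A hA B hB hAB => ?_).le
  exact eq_of_subset_of_card_le hAB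
    (by rw [(mem_filter.1 hA).2.2, (mem_filter.1 hB).2.2])

theorem exists_mem_sdiff_succ {g : ℕ → Finset α} {i j : ℕ}
    (hij : i ≤ j) {a : α} (hai : a ∈ g i) (haj : a ∉ g j) :
    ∃ m, i ≤ m ∧ m < j ∧ a ∈ g m \ g (m + 1) := by
  induction j, hij using Nat.le_induction with
  | base => exact absurd hai haj
  | succ j hij ih =>
    by_cases h : a ∈ g j
    · exact ⟨j, hij, by omega, mem_sdiff.2 ⟨h, haj⟩⟩
    · obtain ⟨m, h1, h2, h3⟩ := ih h
      exact ⟨m, h1, by omega, h3⟩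

open Classical in
/-- In a family with a common point, few members are not the top of a chain of length `c`. -/
theorem WeaklyCrossFreeFam.card_not_top_le {k : ℕ} {F G : Finset (Finset α)}
    (hF : WeaklyCrossFreeFam k F) (hG : G ⊆ F) (z : α) (hz : ∀ A ∈ G, z ∈ A) (c : ℕ) :
    (G.filter fun A => ¬ ∃ g, IsDescChain G c g ∧ g 0 = A).card ≤ c * k := by
  induction c with
  | zero =>
    rw [zero_mul, Nat.le_zero, card_eq_zero, filter_eq_empty_iff]
    intro A hA
    push Not
    exact ⟨fun _ => A, ⟨fun _ _ => hA, fun i hi => absurd hi (Nat.not_lt_zero i)⟩, rfl⟩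
  | succ c ih =>
    have hsub : (G.filter fun A => ¬ ∃ g, IsDescChain G (c + 1) g ∧ g 0 = A) ⊆
        (G.filter fun A => ¬ ∃ g, IsDescChain G c g ∧ g 0 = A) ∪
        (G.filter fun A => (∃ g, IsDescChain G c g ∧ g 0 = A) ∧
          ¬ ∃ g, IsDescChain G (c + 1) g ∧ g 0 = A) := by
      intro A hA
      simp only [mem_union, mem_filter] at hA ⊢
      tauto
    refine (card_le_card hsub).trans ((card_union_le _ _).trans ?_)
    rw [add_mul, one_mul]
    refine add_le_add ih (hF.card_lt_of_antichain ((filter_subset _ _).trans hG) z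
      (fun A hA => hz A (mem_filter.1 hA).1) ?_).le
    intro A hA B hB hAB
    by_contra hne
    obtain ⟨hAG, ⟨g, hg, rfl⟩, -⟩ := mem_filter.1 hA
    obtain ⟨hBG, -, hB'⟩ := mem_filter.1 hB
    refine hB' ⟨fun i => Nat.casesOn i B g, ⟨?_, ?_⟩, rfl⟩
    · rintro (_ | i) hi
      · exact hBG
      · exact hg.1 i (by omega)
    · rintro (_ | i) hi
      · exact hAB.ssubset_of_ne hne
      · exact hg.2 i (by omega)


theorem exists_subset_card_eq_forall_not (bad : ℕ → ℕ → Prop) {q : ℕ} (hq : 0 < q) (r : ℕ) :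
    ∀ W : Finset ℕ, q * r ≤ W.card → (∀ e ∈ W, ∀ L ⊆ W, (∀ l ∈ L, l < e ∧ bad l e) → L.card < q) →
      ∃ I ⊆ W, I.card = r ∧ ∀ l ∈ I, ∀ i ∈ I, l < i → ¬ bad l i := by
  classical
  induction r with
  | zero => exact fun W _ _ => ⟨∅, empty_subset _, rfl, by simp⟩
  | succ r ih =>
    intro W hW hbad
    rcases W.eq_empty_or_nonempty with rfl | hne
    · rw [card_empty, Nat.le_zero, mul_eq_zero] at hW
      omega
    set e := W.max' hne with he
    have heW : e ∈ W := W.max'_mem hne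
    set L := W.filter fun l => l < e ∧ bad l e with hL
    have hLq : L.card < q := hbad e heW L (filter_subset _ _) fun l hl => (mem_filter.1 hl).2
    have hW' : q * r ≤ ((W \ L).erase e).card := by
      have h1 : (W \ L).card - 1 ≤ ((W \ L).erase e).card := pred_card_le_card_erase
      have h2 : W.card - L.card ≤ (W \ L).card := le_card_sdiff _ _
      rw [mul_add, mul_one] at hW
      omega
    have hsub : (W \ L).erase e ⊆ W := (erase_subset _ _).trans sdiff_subset
    obtain ⟨I, hIW, hIr, hI⟩ := ih _ hW' fun i hi L' hL' h =>
      hbad i (hsub hi) L' (hL'.trans hsub) h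
    have heI : e ∉ I := fun h => by simpa using hIW h
    refine ⟨insert e I, insert_subset heW (hIW.trans hsub), by rw [card_insert_of_notMem heI, hIr],
      ?_⟩
    have hlt : ∀ i ∈ I, i < e ∧ ¬ bad i e := by
      intro i hi
      have h1 := hIW hi
      simp only [mem_erase, mem_sdiff, hL, mem_filter] at h1
      have h2 : i ≤ e := W.le_max' i h1.2.1
      have h3 : i < e := lt_of_le_of_ne h2 h1.1
      tauto
    intro l hl i hi hli
    rcases mem_insert.1 hl with rfl | hl
    · rcases mem_insert.1 hi with rfl | hi
      · omega
      · have := (hlt i hi).1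
        omega
    · rcases mem_insert.1 hi with rfl | hi
      · exact (hlt l hl).2
      · exact hI l hl i hi hli

/-- A descending chain of members of `F` whose `i`-th difference has colour `i` under `ψ`, and whose
last member misses at most `K` points of the first. -/
def IsColoredChain (F : Finset (Finset α)) (c K : ℕ) (ψ : α → ℕ) (g : ℕ → Finset α) : Prop :=
  IsDescChain F c g ∧ (∀ i < c, ∀ a ∈ g i \ g (i + 1), ψ a = i) ∧ (g 0).card ≤ (g c).card + K

section Colored

variable {F Γ : Finset (Finset α)} {k c K : ℕ} {ψ : α → ℕ} {g : Finset α → ℕ → Finset α}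
  {x : Finset α → ℕ → α}

theorem WeaklyCrossFreeFam.exists_notMem_of_colored (hF : WeaklyCrossFreeFam k F) (hk : 2 ≤ k)
    (hc : k * (k + 1) ≤ c)
    (hg : ∀ A ∈ Γ, IsColoredChain F c K ψ (g A))
    (hx : ∀ A ∈ Γ, ∀ i < c, x A i ∈ g A i \ g A (i + 1))
    {t : Finset α → ℕ → Finset α} (ht : ∀ A ∈ Γ, ∀ i < c, t A i ∈ Γ)
    (htx : ∀ A ∈ Γ, ∀ i < c, x (t A i) i = x A i)
    (hgt : ∀ A ∈ Γ, ∀ i < c, g A i ⊆ g (t A i) i) {A : Finset α} (hA : A ∈ Γ) :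
    ∃ e < c, ∃ L ⊆ range e, L.card = k ∧ ∀ l ∈ L, x A l ∉ g (t A e) e := by
  by_contra! hcon
  obtain ⟨I, hIc, hIk, hI⟩ := exists_subset_card_eq_forall_not
    (fun l e => x A l ∉ g (t A e) e) (q := k) (by omega) (k + 1) (range c) (by simpa using hc) (by
      intro e he L _ hL
      by_contra! hkL
      obtain ⟨L', hL', hL'k⟩ := exists_subset_card_eq hkL
      obtain ⟨l, hl, hlx⟩ := hcon e (mem_range.1 he) L'
        (fun l hl => mem_range.2 (hL l (hL' hl)).1) hL'k
      exact (hL l (hL' hl)).2 hlx)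
  have hIc' : ∀ i ∈ I, i < c := fun i hi => mem_range.1 (hIc hi)
  have hmem : ∀ l ∈ I, ∀ i ∈ I, l ≠ i → x A l ∈ g (t A i) (i + 1) := by
    intro l hl i hi hli
    have hT : x A l ∈ g (t A i) i := by
      rcases lt_or_gt_of_ne hli with h | h
      · exact not_not.1 (hI l hl i hi h)
      · exact hgt A hA i (hIc' i hi) ((hg A hA).1.subset h.le (hIc' l hl).le
          (mem_sdiff.1 (hx A hA l (hIc' l hl))).1)
    by_contra hn
    have h1 := (hg _ (ht A hA i (hIc' i hi))).2.1 i (hIc' i hi) _ (mem_sdiff.2 ⟨hT, hn⟩)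
    have h2 := (hg A hA).2.1 l (hIc' l hl) _ (hx A hA l (hIc' l hl))
    omega
  have hnot : ∀ i ∈ I, x A i ∉ g (t A i) (i + 1) := by
    intro i hi
    rw [← htx A hA i (hIc' i hi)]
    exact (mem_sdiff.1 (hx _ (ht A hA i (hIc' i hi)) i (hIc' i hi))).2
  have := hF.card_lt_of_pairwise I (fun i => g (t A i) (i + 1))
    (fun i hi => (hg _ (ht A hA i (hIc' i hi))).1.1 _ (hIc' i hi)) (by
      intro i hi j hj hij
      obtain ⟨l, hl, hlij⟩ : ∃ l ∈ I, l ∉ ({i, j} : Finset ℕ) := by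
        by_contra! h
        have h1 := card_le_card (show I ⊆ {i, j} from h)
        have h2 := card_le_two (a := i) (b := j)
        omega
      simp only [mem_insert, mem_singleton, not_or] at hlij
      exact weaklyCrossing_of_not_subset (hmem l hl i hi hlij.1) (hmem l hl j hj hlij.2)
        (fun h => hnot j hj (h (hmem j hj i hi hij.symm)))
        (fun h => hnot i hi (h (hmem i hi j hj hij))))
  omega

theorem WeaklyCrossFreeFam.card_colored_fibre_le (hF : WeaklyCrossFreeFam k F)
    (hΓ : ∀ A ∈ Γ, g A 0 = A)
    (hg : ∀ A ∈ Γ, IsColoredChain F c K ψ (g A))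
    (hx : ∀ A ∈ Γ, ∀ i < c, x A i ∈ g A i \ g A (i + 1))
    {e : ℕ} (he : e < c) {L : Finset ℕ} (hL : L ⊆ range e) (hLk : L.card = k) {T : Finset α} {z : α}
    {r : ℕ} (hz : ∀ A ∈ Γ, z ∈ g A e) (hT : ∀ A ∈ Γ, g A e ⊆ T)
    (hxT : ∀ A ∈ Γ, ∀ l ∈ L, x A l ∉ T) (hr : ∀ A ∈ Γ, A.card % (K + 1) = r) :
    Γ.card ≤ k * k := by
  have hΓF : Γ ⊆ F := fun A hA => by
    have := (hg A hA).1.1 0 (Nat.zero_le _)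
    rwa [hΓ A hA] at this
  have hzA : ∀ A ∈ Γ, z ∈ A := fun A hA => by
    have := (hg A hA).1.subset (Nat.zero_le e) he.le (hz A hA)
    rwa [hΓ A hA] at this
  refine (card_le_mul_card_image (f := card) Γ k ?_).trans (Nat.mul_le_mul_left k ?_)
  · intro s _
    refine (hF.card_lt_of_antichain ((filter_subset _ _).trans hΓF) z
      (fun A hA => hzA A (mem_filter.1 hA).1) fun A hA B hB hAB => ?_).le
    exact eq_of_subset_of_card_le hAB (by rw [(mem_filter.1 hA).2, (mem_filter.1 hB).2])
  by_contra! hlt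
  obtain ⟨N, hN, hNk⟩ := exists_subset_card_eq hlt.le
  have hNA : ∀ s ∈ N, ∃ A ∈ Γ, A.card = s := fun s hs => mem_image.1 (hN hs)
  choose! B hBΓ hBs using hNA
  set sz := N.orderEmbOfFin hNk with hsz
  set lv := L.orderEmbOfFin hLk with hlv
  have hszN : ∀ i, sz i ∈ N := fun i => orderEmbOfFin_mem _ _ _
  have hlvL : ∀ i, lv i ∈ L := fun i => orderEmbOfFin_mem _ _ _
  have hlve : ∀ i, lv i < e := fun i => mem_range.1 (hL (hlvL i))
  set C : Fin k → Finset α := fun i => B (sz i) with hC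
  have hCΓ : ∀ i, C i ∈ Γ := fun i => hBΓ _ (hszN i)
  have hzS : ∀ i, z ∈ g (C i) (lv i + 1) := fun i =>
    (hg _ (hCΓ i)).1.subset (hlve i) he.le (hz _ (hCΓ i))
  have key : ∀ i j, i < j → WeaklyCrossing (g (C i) (lv i + 1)) (g (C j) (lv j + 1)) := by
    intro i j hij
    have hlij : lv i < lv j := (OrderEmbedding.lt_iff_lt lv).2 hij
    have hlj := hlve j
    refine weaklyCrossing_of_not_subset (hzS i) (hzS j) (fun h => ?_) (fun h => ?_)
    · have hxi := hx _ (hCΓ i) (lv j) (by omega)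
      have h1 : x (C i) (lv j) ∈ g (C i) (lv i + 1) :=
        (hg _ (hCΓ i)).1.subset hlij (by omega) (mem_sdiff.1 hxi).1
      obtain ⟨m, hm1, hm2, hm⟩ := exists_mem_sdiff_succ (g := g (C j)) (show lv j + 1 ≤ e from hlj)
        (h h1) (fun h2 => hxT _ (hCΓ i) _ (hlvL j) (hT _ (hCΓ j) h2))
      have h3 := (hg _ (hCΓ j)).2.1 m (by omega) _ hm
      have h4 := (hg _ (hCΓ i)).2.1 (lv j) (by omega) _ hxi
      omega
    · have h1 := card_le_card h
      have h2 := card_le_card ((hg _ (hCΓ i)).1.subset (Nat.zero_le (lv i + 1)) (by omega))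
      have h3 := card_le_card ((hg _ (hCΓ j)).1.subset (show lv j + 1 ≤ c by omega) le_rfl)
      have h4 := (hg _ (hCΓ j)).2.2
      rw [hΓ _ (hCΓ j)] at h4
      rw [hΓ _ (hCΓ i)] at h2
      have h5 : (C i).card < (C j).card := by
        rw [hC]
        simp only
        rw [hBs _ (hszN i), hBs _ (hszN j)]
        exact (OrderEmbedding.lt_iff_lt sz).2 hij
      have h6 : (C i).card ≡ (C j).card [MOD K + 1] :=
        (hr _ (hCΓ i)).trans (hr _ (hCΓ j)).symm
      have h7 := Nat.le_of_dvd (by omega) ((Nat.modEq_iff_dvd' h5.le).1 h6)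
      omega
  have := hF.card_lt_of_pairwise (univ : Finset (Fin k)) (fun i => g (C i) (lv i + 1))
    (fun i _ => (hg _ (hCΓ i)).1.1 _ (by have := hlve i; omega)) (by
      intro i _ j _ hij
      rcases lt_or_gt_of_ne hij with h | h
      · exact key i j h
      · exact (key j i h).symm)
  simp at this

theorem WeaklyCrossFreeFam.card_colored_le (hF : WeaklyCrossFreeFam k F) (hk : 2 ≤ k)
    (hc : k * (k + 1) ≤ c) {X : Finset α} (hX : ∀ A ∈ F, A ⊆ X)
    (hΓ : ∀ A ∈ Γ, g A 0 = A) (hg : ∀ A ∈ Γ, IsColoredChain F c K ψ (g A)) :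
    Γ.card ≤ c * (2 ^ c * ((K + 1) * (X.card * (k * (k * k))))) := by
  have hΓx : ∀ A ∈ Γ, ∀ i < c, ∃ a, a ∈ g A i \ g A (i + 1) := fun A hA i hi =>
    sdiff_nonempty.2 ((hg A hA).1.2 i hi).2
  have hα : Γ = ∅ ∨ Nonempty α := by
    rcases Γ.eq_empty_or_nonempty with h | ⟨A, hA⟩
    · exact .inl h
    · obtain ⟨a, -⟩ := hΓx A hA 0 (by nlinarith)
      exact .inr ⟨a⟩
  rcases hα with rfl | hα
  · simp
  choose! x hx using hΓx
  have hmax : ∀ A ∈ Γ, ∀ i < c, ∃ B ∈ Γ, x B i = x A i ∧ g A i ⊆ g B i ∧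
      ∀ C ∈ Γ, x C i = x A i → g B i ⊆ g C i → g B i = g C i := by
    intro A hA i hi
    obtain ⟨B, hB, hBmax⟩ := exists_max_image (Γ.filter fun B => x B i = x A i ∧ g A i ⊆ g B i)
      (fun B => (g B i).card) ⟨A, mem_filter.2 ⟨hA, rfl, Subset.rfl⟩⟩
    obtain ⟨hBΓ, hBx, hAB⟩ := mem_filter.1 hB
    exact ⟨B, hBΓ, hBx, hAB, fun C hC hCx hBC =>
      eq_of_subset_of_card_le hBC (hBmax C (mem_filter.2 ⟨hC, hCx, hAB.trans hBC⟩))⟩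
  choose! t ht htx hgt htmax using hmax
  have hlow : ∀ A ∈ Γ, ∃ e < c, ∃ L ⊆ range e, L.card = k ∧ ∀ l ∈ L, x A l ∉ g (t A e) e :=
    fun A hA => hF.exists_notMem_of_colored hk hc hg hx ht htx hgt hA
  choose! e hec L hLe hLk hLx using hlow
  have hxX : ∀ A ∈ Γ, ∀ i < c, x A i ∈ X := fun A hA i hi =>
    hX _ ((hg A hA).1.1 i hi.le) (mem_sdiff.1 (hx A hA i hi)).1
  have hcover : Γ ⊆ (range c).biUnion fun e' => (range c).powerset.biUnion fun L' =>
      (range (K + 1)).biUnion fun r => X.biUnion fun z =>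
      ((Γ.filter fun A => e' < c ∧ x A e' = z).image fun A => g (t A e') e').biUnion fun T =>
      Γ.filter fun A => e A = e' ∧ L A = L' ∧ A.card % (K + 1) = r ∧ x A e' = z ∧
        g (t A e') e' = T := by
    intro A hA
    simp only [mem_biUnion, mem_range, mem_powerset, mem_image, mem_filter]
    exact ⟨e A, hec A hA, L A, (hLe A hA).trans (range_mono (hec A hA).le), A.card % (K + 1),
      Nat.mod_lt _ (Nat.succ_pos K), x A (e A), hxX A hA _ (hec A hA), g (t A (e A)) (e A),
      ⟨A, ⟨hA, hec A hA, rfl⟩, rfl⟩, hA, rfl, rfl, rfl, rfl, rfl⟩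
  refine (card_le_card hcover).trans ?_
  refine (card_biUnion_le_card_mul _ _ _ fun e' _ => ?_).trans (by rw [card_range])
  refine (card_biUnion_le_card_mul _ _ _ fun L' _ => ?_).trans (by rw [card_powerset, card_range])
  refine (card_biUnion_le_card_mul _ _ _ fun r _ => ?_).trans (by rw [card_range])
  refine card_biUnion_le_card_mul _ _ _ fun z _ => ?_
  refine (card_biUnion_le_card_mul _ _ (k * k) fun T _ => ?_).trans (Nat.mul_le_mul_right _ ?_)
  · set Δ := Γ.filter fun A => e A = e' ∧ L A = L' ∧ A.card % (K + 1) = r ∧ x A e' = z ∧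
        g (t A e') e' = T with hΔ
    have hΔΓ : Δ ⊆ Γ := filter_subset _ _
    rcases Δ.eq_empty_or_nonempty with h0 | ⟨A₀, hA₀⟩
    · rw [h0]; simp
    obtain ⟨h0, rfl, rfl, -⟩ := mem_filter.1 hA₀
    refine hF.card_colored_fibre_le (Γ := Δ) (g := g) (x := x) (z := z) (T := T) (r := r)
      (fun A hA => hΓ A (hΔΓ hA)) (fun A hA => hg A (hΔΓ hA)) (fun A hA => hx A (hΔΓ hA))
      (hec _ h0) (hLe _ h0) (hLk _ h0) ?_ ?_ ?_ ?_
    · intro A hA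
      obtain ⟨hAΓ, -, -, -, rfl, -⟩ := mem_filter.1 hA
      exact (mem_sdiff.1 (hx A hAΓ _ (hec _ h0))).1
    · intro A hA
      obtain ⟨hAΓ, -, -, -, -, rfl⟩ := mem_filter.1 hA
      exact hgt A hAΓ _ (hec _ h0)
    · intro A hA l hl
      obtain ⟨hAΓ, he, hL, -, -, hT⟩ := mem_filter.1 hA
      rw [← hT, ← he]
      rw [← hL] at hl
      exact hLx A hAΓ l hl
    · exact fun A hA => (mem_filter.1 hA).2.2.2.1
  · refine (hF.card_lt_of_antichain ?_ z ?_ ?_).le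
    · intro T hT
      obtain ⟨A, hA, rfl⟩ := mem_image.1 hT
      obtain ⟨hAΓ, hc', -⟩ := mem_filter.1 hA
      exact (hg _ (ht A hAΓ _ hc')).1.1 _ hc'.le
    · intro T hT
      obtain ⟨A, hA, rfl⟩ := mem_image.1 hT
      obtain ⟨hAΓ, hc', rfl⟩ := mem_filter.1 hA
      exact hgt A hAΓ _ hc' (mem_sdiff.1 (hx A hAΓ _ hc')).1
    · intro T hT T' hT' hsub
      obtain ⟨A, hA, rfl⟩ := mem_image.1 hT
      obtain ⟨hAΓ, hc', hAx⟩ := mem_filter.1 hA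
      obtain ⟨B, hB, rfl⟩ := mem_image.1 hT'
      obtain ⟨hBΓ, -, hBx⟩ := mem_filter.1 hB
      exact htmax A hAΓ _ hc' _ (ht B hBΓ _ hc') (by rw [htx B hBΓ _ hc', hAx, hBx]) hsub

end Colored

section Random

theorem card_piFinset_ite_mul {β : Type*} [Fintype α] [Fintype β] (D : Finset α)
    (s : α → Finset β) (p : ℕ) (hs : ∀ a ∈ D, (s a).card = p) :
    (Fintype.piFinset fun a => if a ∈ D then s a else univ).card * Fintype.card β ^ D.card =
      p ^ D.card * Fintype.card β ^ Fintype.card α := by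
  have h : ∀ a, (if a ∈ D then s a else univ).card = if a ∈ D then p else Fintype.card β := by
    intro a
    split_ifs with ha
    · exact hs a ha
    · rfl
  rw [Fintype.card_piFinset, prod_congr rfl fun a _ => h a, prod_ite, prod_const, prod_const,
    filter_mem_eq_inter, univ_inter, filter_notMem_eq_sdiff, ← compl_eq_univ_sdiff, mul_assoc,
    ← pow_add, card_compl_add_card]

/-- `A` starts a descending chain of length `c` whose last member misses at most `K` points. -/
def IsTight (F : Finset (Finset α)) (c K : ℕ) (A : Finset α) : Prop :=
  ∃ g, IsDescChain F c g ∧ g 0 = A ∧ A.card ≤ (g c).card + K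

theorem IsDescChain.le_card_coloring [Fintype α] {F : Finset (Finset α)} {c K : ℕ}
    {g : ℕ → Finset α} (hg : IsDescChain F c g) (hc : 0 < c) (hK : (g 0).card ≤ (g c).card + K) :
    c ^ Fintype.card α ≤ c ^ K *
      (univ.filter fun ψ : α → Fin c => ∀ i < c, ∀ a ∈ g i \ g (i + 1), (ψ a : ℕ) = i).card := by
  have hex : ∀ a, ∃ j : Fin c, ∀ i < c, a ∈ g i \ g (i + 1) → (j : ℕ) = i := by
    intro a
    by_cases h : ∃ i < c, a ∈ g i \ g (i + 1)
    · obtain ⟨j, hj, haj⟩ := h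
      refine ⟨⟨j, hj⟩, fun i hi hai => ?_⟩
      rw [mem_sdiff] at haj hai
      rcases lt_trichotomy j i with h | h | h
      · exact absurd (hg.subset h hi.le hai.1) haj.2
      · exact h
      · exact absurd (hg.subset h hj.le haj.1) hai.2
    · exact ⟨⟨0, hc⟩, fun i hi hai => absurd ⟨i, hi, hai⟩ h⟩
  choose ψ₀ hψ₀ using hex
  have hcount := card_piFinset_ite_mul (g 0 \ g c) (fun a => {ψ₀ a}) 1 fun _ _ => card_singleton _
  rw [Fintype.card_fin, one_pow, one_mul] at hcount
  rw [← hcount, mul_comm]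
  have hD : (g 0 \ g c).card ≤ K := by
    rw [card_sdiff_of_subset (hg.subset (Nat.zero_le c) le_rfl)]
    omega
  refine Nat.mul_le_mul (Nat.pow_le_pow_right hc hD) (card_le_card fun ψ hψ => ?_)
  rw [Fintype.mem_piFinset] at hψ
  refine mem_filter.2 ⟨mem_univ _, fun i hi a ha => ?_⟩
  have haD : a ∈ g 0 \ g c := by
    rw [mem_sdiff] at ha ⊢
    exact ⟨hg.subset (Nat.zero_le i) hi.le ha.1, fun h => ha.2 (hg.subset hi le_rfl h)⟩
  have := hψ a
  rw [if_pos haD, mem_singleton] at this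
  rw [this]
  exact hψ₀ a i hi ha

open Classical in
theorem WeaklyCrossFreeFam.card_tight_le [Fintype α] {k c K : ℕ} {F : Finset (Finset α)}
    {X : Finset α} (hF : WeaklyCrossFreeFam k F) (hk : 2 ≤ k) (hc : k * (k + 1) ≤ c)
    (hX : ∀ A ∈ F, A ⊆ X) :
    (F.filter (IsTight F c K)).card ≤
      c ^ K * (c * (2 ^ c * ((K + 1) * (X.card * (k * (k * k)))))) := by
  set Ft := F.filter (IsTight F c K) with hFt
  have hc0 : 0 < c := by nlinarith
  have hch : ∀ A ∈ Ft, ∃ g, IsDescChain F c g ∧ g 0 = A ∧ A.card ≤ (g c).card + K :=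
    fun A hA => (mem_filter.1 hA).2
  choose! g hg hg0 hgK using hch
  set R := c * (2 ^ c * ((K + 1) * (X.card * (k * (k * k))))) with hR
  let P : (α → Fin c) → Finset α → Prop := fun ψ A =>
    ∀ i < c, ∀ a ∈ g A i \ g A (i + 1), (ψ a : ℕ) = i
  have h1 : ∀ A ∈ Ft, c ^ Fintype.card α ≤ c ^ K * (univ.filter fun ψ => P ψ A).card := by
    intro A hA
    convert (hg A hA).le_card_coloring hc0 (K := K) (by rw [hg0 A hA]; exact hgK A hA)
  have h2 : ∀ ψ, (Ft.filter (P ψ)).card ≤ R := fun ψ =>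
    hF.card_colored_le (Γ := Ft.filter (P ψ)) (g := g) (ψ := fun a => (ψ a : ℕ)) hk hc hX
      (fun A hA => hg0 A (mem_filter.1 hA).1) fun A hA => by
        obtain ⟨hA, hP⟩ := mem_filter.1 hA
        exact ⟨hg A hA, hP, by rw [hg0 A hA]; exact hgK A hA⟩
  have h3 : ∑ A ∈ Ft, (univ.filter fun ψ => P ψ A).card = ∑ ψ, (Ft.filter (P ψ)).card := by
    simp only [card_filter]
    exact sum_comm
  have h4 : Ft.card * c ^ Fintype.card α ≤ c ^ K * R * c ^ Fintype.card α := by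
    calc Ft.card * c ^ Fintype.card α
        ≤ ∑ A ∈ Ft, c ^ K * (univ.filter fun ψ => P ψ A).card := by
          rw [← smul_eq_mul]
          exact card_nsmul_le_sum _ _ _ h1
      _ = c ^ K * ∑ ψ, (Ft.filter (P ψ)).card := by rw [← mul_sum, h3]
      _ ≤ c ^ K * (c ^ Fintype.card α * R) := by
          refine Nat.mul_le_mul_left _ ((sum_le_card_nsmul _ _ R fun ψ _ => h2 ψ).trans ?_)
          rw [card_univ, Fintype.card_fun, Fintype.card_fin, smul_eq_mul]
      _ = _ := by ring
  exact Nat.le_of_mul_le_mul_right h4 (by positivity)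

theorem card_avoiding_le [Fintype α] {m r M : ℕ} (hM : M * m ^ r ≤ (m + 1) ^ r) {D : Finset α}
    (hD : r ≤ D.card) :
    M * (univ.filter fun χ : α → Fin (m + 1) => ∀ a ∈ D, χ a ≠ 0).card ≤
      (m + 1) ^ Fintype.card α := by
  obtain ⟨E, hED, rfl⟩ := exists_subset_card_eq hD
  have hcount := card_piFinset_ite_mul (β := Fin (m + 1)) E (fun _ => univ.erase 0) m
    fun _ _ => by simp
  rw [Fintype.card_fin] at hcount
  have hsub : (univ.filter fun χ : α → Fin (m + 1) => ∀ a ∈ D, χ a ≠ 0) ⊆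
      Fintype.piFinset fun a => if a ∈ E then univ.erase 0 else univ := by
    intro χ hχ
    rw [Fintype.mem_piFinset]
    intro a
    split_ifs with ha
    · simpa using (mem_filter.1 hχ).2 a (hED ha)
    · exact mem_univ _
  refine (Nat.mul_le_mul_left M (card_le_card hsub)).trans
    (Nat.le_of_mul_le_mul_right (c := (m + 1) ^ E.card) ?_ (by positivity))
  rw [mul_assoc, hcount, ← mul_assoc, mul_comm _ ((m + 1) ^ E.card)]
  exact Nat.mul_le_mul_right _ hM

theorem sum_card_filter_eq_zero_mul [Fintype α] (m : ℕ) (X : Finset α) :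
    (∑ χ : α → Fin (m + 1), (X.filter fun a => χ a = 0).card) * (m + 1) =
      X.card * (m + 1) ^ Fintype.card α := by
  have h : ∀ a ∈ X, (∑ χ : α → Fin (m + 1), if χ a = 0 then 1 else 0) * (m + 1) =
      (m + 1) ^ Fintype.card α := by
    intro a _
    have hcount := card_piFinset_ite_mul (β := Fin (m + 1)) {a} (fun _ => {0}) 1 fun _ _ => by simp
    rw [Fintype.card_fin, card_singleton, pow_one, one_pow, one_mul] at hcount
    rw [← hcount, ← card_filter]
    congr 2
    ext χ
    simp only [mem_filter, mem_univ, true_and, Fintype.mem_piFinset, mem_singleton]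
    refine ⟨fun h b => ?_, fun h => by simpa using h a⟩
    split_ifs with hb
    · rw [hb, mem_singleton, h]
    · exact mem_univ _
  simp only [card_filter]
  rw [sum_comm, sum_mul, sum_congr rfl h, sum_const, smul_eq_mul]

open Classical in
theorem WeaklyCrossFreeFam.exists_bottoms {k : ℕ} {F : Finset (Finset α)}
    (hF : WeaklyCrossFreeFam k F) (c : ℕ) (A Q : Finset α) :
    ∃ S : Finset (Finset α), S.card ≤ Q.card * k ∧
      (∀ B ∈ S, ∃ g, IsDescChain F c g ∧ g 0 = A ∧ g c = B) ∧
      ∀ g, IsDescChain F c g → g 0 = A → ∀ z ∈ Q, z ∈ g c → ∃ B ∈ S, g c ⊆ B := by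
  let R : α → Finset (Finset α) := fun z =>
    F.filter fun B => z ∈ B ∧ ∃ g, IsDescChain F c g ∧ g 0 = A ∧ g c = B
  refine ⟨Q.biUnion fun z => (R z).filter (Maximal (· ∈ R z)), ?_, ?_, ?_⟩
  · refine card_biUnion_le_card_mul _ _ _ fun z _ => (hF.card_lt_of_antichain
      ((filter_subset _ _).trans (filter_subset _ _)) z
      (fun B hB => (mem_filter.1 (mem_filter.1 hB).1).2.1) fun B hB C hC hBC => ?_).le
    exact (mem_filter.1 hB).2.eq_of_le (mem_filter.1 hC).1 hBC
  · intro B hB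
    obtain ⟨z, -, hB⟩ := mem_biUnion.1 hB
    exact (mem_filter.1 (mem_filter.1 hB).1).2.2
  · intro g hg hg0 z hz hzg
    obtain ⟨B, hB, hmax⟩ := (R z).exists_le_maximal
      (mem_filter.2 ⟨hg.1 c le_rfl, hzg, g, hg, hg0, rfl⟩)
    exact ⟨B, mem_biUnion.2 ⟨z, hz, mem_filter.2 ⟨hmax.prop, hmax⟩⟩, hB⟩

open Classical in
/-- Within the classes of sets having a given nonempty trace on `Y`, few sets are not the top of a
chain of length `c`. -/
theorem WeaklyCrossFreeFam.card_shallow_le {k : ℕ} {F : Finset (Finset α)}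
    (hF : WeaklyCrossFreeFam k F) (c : ℕ) (Y : Finset α) :
    (F.filter fun A => (A ∩ Y).Nonempty ∧
      ¬ ∃ g, IsDescChain (F.filter fun B => B ∩ Y = A ∩ Y) c g ∧ g 0 = A).card ≤
      ((F.image (· ∩ Y)).erase ∅).card * (c * k) := by
  refine (card_le_card (t := ((F.image (· ∩ Y)).erase ∅).biUnion fun T =>
    (F.filter fun B => B ∩ Y = T).filter fun A =>
      ¬ ∃ g, IsDescChain (F.filter fun B => B ∩ Y = T) c g ∧ g 0 = A) fun A hA => ?_).trans
    (card_biUnion_le_card_mul _ _ _ fun T hT => ?_)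
  · obtain ⟨hAF, hne, hA⟩ := mem_filter.1 hA
    exact mem_biUnion.2 ⟨A ∩ Y, mem_erase.2 ⟨hne.ne_empty, mem_image_of_mem _ hAF⟩,
      mem_filter.2 ⟨mem_filter.2 ⟨hAF, rfl⟩, hA⟩⟩
  · obtain ⟨z, hz⟩ := nonempty_iff_ne_empty.2 (mem_erase.1 hT).1
    exact hF.card_not_top_le (filter_subset _ _) z
      (fun A hA => by
        rw [← (mem_filter.1 hA).2] at hz
        exact (mem_inter.1 hz).1) c

open Classical in
theorem WeaklyCrossFreeFam.card_avoiding_of_not_tight [Fintype α] {k c K q m : ℕ}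
    {F : Finset (Finset α)} (hF : WeaklyCrossFreeFam k F)
    (hq : 8 * m ^ q ≤ (m + 1) ^ q) (hK : 8 * (q * k) * m ^ K ≤ (m + 1) ^ K)
    {A : Finset α} (hAq : q ≤ A.card) (hA : ¬ IsTight F c K A) :
    ∃ S : Finset (α → Fin (m + 1)), 4 * S.card ≤ (m + 1) ^ Fintype.card α ∧
      ∀ χ ∉ S, ∀ Y : Finset α, (∀ a ∈ A, χ a = 0 ↔ a ∈ Y) → (A ∩ Y).Nonempty ∧
        ¬ ∃ g, IsDescChain (F.filter fun B => B ∩ Y = A ∩ Y) c g ∧ g 0 = A := by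
  obtain ⟨Q, hQA, hQ⟩ := exists_subset_card_eq hAq
  obtain ⟨T, hTcard, hT, hTmax⟩ := hF.exists_bottoms c A Q
  let V : Finset α → Finset (α → Fin (m + 1)) := fun D => univ.filter fun χ => ∀ a ∈ D, χ a ≠ 0
  have hV1 : 8 * (V Q).card ≤ (m + 1) ^ Fintype.card α := by
    convert card_avoiding_le hq hQ.ge
  have hV2 : 8 * (T.biUnion fun B => V (A \ B)).card ≤ (m + 1) ^ Fintype.card α := by
    have h : ∀ B ∈ T, (V (A \ B)).card ≤ (m + 1) ^ Fintype.card α / (8 * (q * k)) := by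
      intro B hB
      have hpos : 0 < 8 * (q * k) := by
        have := card_pos.2 ⟨B, hB⟩
        rw [hQ] at hTcard
        omega
      rw [Nat.le_div_iff_mul_le hpos, mul_comm]
      obtain ⟨g, hg, hg0, rfl⟩ := hT B hB
      have hgA : g c ⊆ A := hg0 ▸ hg.subset (Nat.zero_le c) le_rfl
      have hlt : (g c).card + K < A.card := by
        by_contra! h
        exact hA ⟨g, hg, hg0, h⟩
      convert card_avoiding_le hK (D := A \ g c) (by rw [card_sdiff_of_subset hgA]; omega)
    rw [hQ] at hTcard
    calc 8 * (T.biUnion fun B => V (A \ B)).card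
        ≤ 8 * (q * k * ((m + 1) ^ Fintype.card α / (8 * (q * k)))) :=
          Nat.mul_le_mul_left _ ((card_biUnion_le_card_mul _ _ _ h).trans
            (Nat.mul_le_mul_right _ hTcard))
      _ = 8 * (q * k) * ((m + 1) ^ Fintype.card α / (8 * (q * k))) := by ring
      _ ≤ _ := Nat.mul_div_le _ _
  refine ⟨V Q ∪ T.biUnion fun B => V (A \ B), ?_, ?_⟩
  · have := card_union_le (V Q) (T.biUnion fun B => V (A \ B))
    omega
  intro χ hχ Y hY
  simp only [V, mem_union, mem_biUnion, mem_filter, mem_univ, true_and, not_or, not_forall,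
    not_exists, not_and, not_not] at hχ
  obtain ⟨⟨z, hzQ, hz⟩, hχT⟩ := hχ
  have hzA := hQA hzQ
  have hzY := (hY z hzA).1 hz
  refine ⟨⟨z, mem_inter.2 ⟨hzA, hzY⟩⟩, ?_⟩
  rintro ⟨g, hg, hg0⟩
  have hgc : g c ∩ Y = A ∩ Y := (mem_filter.1 (hg.1 c le_rfl)).2
  have hzg : z ∈ g c := (mem_inter.1 (hgc ▸ mem_inter.2 ⟨hzA, hzY⟩)).1
  obtain ⟨B, hB, hgB⟩ := hTmax g (hg.mono (filter_subset _ _)) hg0 z hzQ hzg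
  obtain ⟨a, ha, ha0⟩ := hχT B hB
  rw [mem_sdiff] at ha
  exact ha.2 (hgB (mem_inter.1 (hgc ▸ mem_inter.2 ⟨ha.1, (hY a ha.1).1 ha0⟩)).1)

open Classical in
theorem WeaklyCrossFreeFam.card_not_tight_le [Fintype α] {k c K q m : ℕ}
    {F : Finset (Finset α)} {X : Finset α} (hF : WeaklyCrossFreeFam k F) (hX : ∀ A ∈ F, A ⊆ X)
    (hX0 : 0 < X.card) (hm : 8 * (c * k) ≤ m + 1)
    (hq : 8 * m ^ q ≤ (m + 1) ^ q) (hK : 8 * (q * k) * m ^ K ≤ (m + 1) ^ K)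
    (hdense : ∀ Y ⊆ X, ((F.image (· ∩ Y)).erase ∅).card * X.card ≤ F.card * Y.card) :
    6 * (F.filter fun A => q ≤ A.card ∧ ¬ IsTight F c K A).card ≤ F.card := by
  set N := F.filter fun A => q ≤ A.card ∧ ¬ IsTight F c K A with hN
  set W := (m + 1) ^ Fintype.card α with hW
  have hW0 : 0 < W := by positivity
  have hS := fun A (hA : A ∈ N) =>
    hF.card_avoiding_of_not_tight hq hK (mem_filter.1 hA).2.1 (mem_filter.1 hA).2.2
  choose! S hS4 hS using hS
  let Y : (α → Fin (m + 1)) → Finset α := fun χ => X.filter fun a => χ a = 0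
  have hcover : ∀ χ, N.card ≤ (N.filter fun A => χ ∈ S A).card +
      ((F.image (· ∩ Y χ)).erase ∅).card * (c * k) := by
    intro χ
    rw [← card_filter_add_card_filter_not (fun A => χ ∈ S A)]
    refine Nat.add_le_add_left ((card_le_card fun A hA => ?_).trans (hF.card_shallow_le c (Y χ))) _
    obtain ⟨hAN, hA⟩ := mem_filter.1 hA
    have hAF := (mem_filter.1 hAN).1
    exact mem_filter.2 ⟨hAF, hS A hAN χ hA (Y χ) fun a ha =>
      ⟨fun h => mem_filter.2 ⟨hX A hAF ha, h⟩, fun h => (mem_filter.1 h).2⟩⟩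
  have hY : (∑ χ, (Y χ).card) * (m + 1) = X.card * W := sum_card_filter_eq_zero_mul m X
  have hsum : N.card * W ≤ ∑ A ∈ N, (S A).card +
      (∑ χ, ((F.image (· ∩ Y χ)).erase ∅).card) * (c * k) := by
    have h := sum_le_sum fun χ (_ : χ ∈ univ) => hcover χ
    rw [sum_const, card_univ, Fintype.card_fun, Fintype.card_fin, smul_eq_mul, mul_comm,
      sum_add_distrib, ← sum_mul] at h
    refine h.trans_eq ?_
    congr 1
    simp only [card_filter]
    rw [sum_comm]
    simp
  have hS' : 4 * ∑ A ∈ N, (S A).card ≤ N.card * W := by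
    rw [mul_sum, ← smul_eq_mul (N.card)]
    exact sum_le_card_nsmul _ _ _ hS4
  have htr : (∑ χ, ((F.image (· ∩ Y χ)).erase ∅).card) * X.card ≤ F.card * ∑ χ, (Y χ).card := by
    rw [sum_mul, mul_sum]
    exact sum_le_sum fun χ _ => hdense _ (filter_subset _ _)
  set s := ∑ A ∈ N, (S A).card
  set τ := ∑ χ, ((F.image (· ∩ Y χ)).erase ∅).card
  set y := ∑ χ, (Y χ).card
  have h1 : 3 * (N.card * W) ≤ 4 * (τ * (c * k)) := by omega
  have h2 : 6 * (N.card * W) * (X.card * (m + 1)) ≤ F.card * W * (X.card * (m + 1)) := by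
    calc 6 * (N.card * W) * (X.card * (m + 1))
        = 2 * (3 * (N.card * W)) * (X.card * (m + 1)) := by ring
      _ ≤ 2 * (4 * (τ * (c * k))) * (X.card * (m + 1)) := by gcongr
      _ = (τ * X.card) * (8 * (c * k)) * (m + 1) := by ring
      _ ≤ (F.card * y) * (m + 1) * (m + 1) := by gcongr
      _ = F.card * (y * (m + 1)) * (m + 1) := by ring
      _ = F.card * W * (X.card * (m + 1)) := by rw [hY]; ring
  have h3 := Nat.le_of_mul_le_mul_right h2 (by positivity)
  exact Nat.le_of_mul_le_mul_right (by linarith) hW0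

end Random

end CrossFree

theorem exists_mul_pow_le_succ_pow (M m : ℕ) : ∃ r, M * m ^ r ≤ (m + 1) ^ r := by
  have h1 : (m / (m + 1) : ℝ) < 1 := by
    rw [div_lt_one (by positivity)]
    linarith
  obtain ⟨r, hr⟩ := exists_pow_lt_of_lt_one (show (0 : ℝ) < 1 / (M + 1) by positivity) h1
  refine ⟨r, ?_⟩
  rw [div_pow, div_lt_div_iff₀ (by positivity) (by positivity), one_mul] at hr
  have h2 : (m : ℝ) ^ r * (M + 1) ≥ M * m ^ r := by
    have : (0 : ℝ) ≤ (m : ℝ) ^ r := by positivity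
    linarith
  exact_mod_cast h2.le.trans hr.le

open Classical in
theorem exists_card_le_mul_of_fintype (k : ℕ) (hk : 2 ≤ k) :
    ∃ M : ℕ, ∀ (α : Type) [DecidableEq α] [Fintype α] (X : Finset α) (F : Finset (Finset α)),
      (∀ A ∈ F, A ⊆ X) → (∀ A ∈ F, A.Nonempty) → WeaklyCrossFreeFam k F →
        F.card ≤ M * X.card := by
  obtain ⟨c, hc⟩ : ∃ c, c = k * (k + 1) := ⟨_, rfl⟩
  obtain ⟨m, hm⟩ : ∃ m, m = 8 * (c * k) := ⟨_, rfl⟩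
  obtain ⟨q, hq⟩ := exists_mul_pow_le_succ_pow 8 m
  obtain ⟨K, hK⟩ := exists_mul_pow_le_succ_pow (8 * (q * k)) m
  set R := c ^ K * c * 2 ^ c * (K + 1) * k ^ 3 with hR
  refine ⟨2 * (q * k + R), fun α _ _ X => ?_⟩
  induction X using Finset.strongInduction with
  | H X ih =>
    intro F hX hne hF
    by_contra! hlt
    have hX0 : 0 < X.card := by
      obtain ⟨A, hA⟩ := card_pos.1 (Nat.zero_lt_of_lt hlt)
      exact card_pos.2 ((hne A hA).mono (hX A hA))
    have hdense : ∀ Y ⊆ X, ((F.image (· ∩ Y)).erase ∅).card * X.card ≤ F.card * Y.card := by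
      intro Y hYX
      rcases eq_or_ssubset_of_subset hYX with rfl | hYX
      · exact Nat.mul_le_mul_right _ ((card_erase_le).trans card_image_le)
      · have h := ih Y hYX ((F.image (· ∩ Y)).erase ∅)
          (fun A hA => by
            obtain ⟨B, -, rfl⟩ := mem_image.1 (mem_of_mem_erase hA)
            exact inter_subset_right)
          (fun A hA => nonempty_iff_ne_empty.2 (mem_erase.1 hA).1) (hF.trace Y)
        calc ((F.image (· ∩ Y)).erase ∅).card * X.card
            ≤ 2 * (q * k + R) * Y.card * X.card := Nat.mul_le_mul_right _ h
          _ = 2 * (q * k + R) * X.card * Y.card := by ring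
          _ ≤ F.card * Y.card := Nat.mul_le_mul_right _ hlt.le
    have h1 := hF.card_small_le hX hne q
    have h2 := hF.card_tight_le (K := K) hk hc.ge hX
    have h3 := hF.card_not_tight_le (c := c) hX hX0 (by omega) hq hK hdense
    have h4 : F.card ≤ (F.filter fun A => A.card < q).card + (F.filter (IsTight F c K)).card +
        (F.filter fun A => q ≤ A.card ∧ ¬ IsTight F c K A).card := by
      refine (card_le_card fun A hA => ?_).trans
        ((card_union_le _ _).trans (Nat.add_le_add_right (card_union_le _ _) _))
      simp only [mem_union, mem_filter]
      have := lt_or_ge A.card q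
      tauto
    have h5 : c ^ K * (c * (2 ^ c * ((K + 1) * (X.card * (k * (k * k)))))) = R * X.card := by
      rw [hR]
      ring
    have h6 : 2 * (q * k + R) * X.card = 2 * (X.card * (q * k)) + 2 * (R * X.card) := by ring
    omega

theorem WeaklyCrossFreeFam.image_subtype {α : Type*} [DecidableEq α] {k : ℕ}
    {F : Finset (Finset α)} (hF : WeaklyCrossFreeFam k F) (X : Finset α) :
    WeaklyCrossFreeFam k (F.image fun A => A.subtype (· ∈ X)) := by
  rintro ⟨S, hS, hk, hp⟩
  have hpre : ∀ A ∈ S, ∃ B ∈ F, B.subtype (· ∈ X) = A := fun A hA => mem_image.1 (hS hA)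
  choose! h hhF hh using hpre
  refine absurd (hF.card_lt_of_pairwise S h hhF ?_) (by omega)
  intro A hA B hB hne
  obtain ⟨⟨a, ha⟩, ⟨b, hb⟩, ⟨d, hd⟩⟩ := hp (mem_coe.2 hA) (mem_coe.2 hB) hne
  rw [← hh A hA, ← hh B hB] at ha hb hd
  simp only [mem_inter, mem_sdiff, mem_subtype] at ha hb hd
  exact ⟨⟨a, mem_inter.2 ha⟩, ⟨b, mem_sdiff.2 hb⟩, ⟨d, mem_sdiff.2 hd⟩⟩

theorem weakly_cross_free_linear (k : ℕ) (hk : 2 ≤ k) :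
    ∃ c : ℝ, 0 < c ∧
      ∀ (α : Type) [DecidableEq α] (X : Finset α) (F : Finset (Finset α)),
        1 ≤ X.card → (∀ A ∈ F, A ⊆ X) → WeaklyCrossFreeFam k F →
        (F.card : ℝ) ≤ c * X.card := by
  obtain ⟨M, hM⟩ := exists_card_le_mul_of_fintype k hk
  refine ⟨M + 1, by positivity, fun α _ X F hX hFX hF => ?_⟩
  have hinj : Set.InjOn (fun A : Finset α => A.subtype (· ∈ X)) (F : Set (Finset α)) := by
    intro A hA B hB hAB
    rw [← subtype_map_of_mem (p := (· ∈ X)) (hFX A hA),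
      ← subtype_map_of_mem (p := (· ∈ X)) (hFX B hB)]
    exact congrArg _ hAB
  have h := hM {a // a ∈ X} univ ((F.image fun A => A.subtype (· ∈ X)).erase ∅)
    (fun A _ => subset_univ A) (fun A hA => nonempty_iff_ne_empty.2 (mem_erase.1 hA).1)
    ((hF.image_subtype X).mono (erase_subset _ _))
  rw [card_univ, Fintype.card_coe] at h
  have h' : F.card - 1 ≤ ((F.image fun A => A.subtype (· ∈ X)).erase ∅).card := by
    rw [← card_image_of_injOn hinj]
    exact pred_card_le_card_erase
  have : F.card ≤ (M + 1) * X.card := by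
    rw [add_mul, one_mul]
    omega
  exact_mod_cast this
end

section
/- Let X be a finite set of size n, let k ≥ 2 and ℓ ≥ 1 be integers, and let F ⊆ 2^X be a weakly-k-cross-free family such that every member of F has size exactly ℓ. Then |F| ≤ (k − 1) · n / ℓ. -/
open Finset

theorem WeaklyCrossing.of_card_eq {α : Type*} [DecidableEq α] {A B : Finset α}
    (hcard : A.card = B.card) (hne : A ≠ B) (hAB : (A ∩ B).Nonempty) :
    WeaklyCrossing A B := by
  refine ⟨hAB, ?_, ?_⟩
  · rw [sdiff_nonempty]
    exact fun h => hne (eq_of_subset_of_card_le h hcard.ge)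
  · rw [sdiff_nonempty]
    exact fun h => hne (eq_of_subset_of_card_le h hcard.le).symm

/-- In a uniform weakly-`k`-cross-free family every point has degree less than `k`. -/
theorem WeaklyCrossFreeFam.card_filter_mem_lt {α : Type*} [DecidableEq α] {k ℓ : ℕ}
    {F : Finset (Finset α)} (hF : WeaklyCrossFreeFam k F)
    (hcard : ∀ A ∈ F, A.card = ℓ) (x : α) : (F.filter (x ∈ ·)).card < k := by
  by_contra! h
  obtain ⟨S, hS, hSk⟩ := exists_subset_card_eq h
  refine hF ⟨S, hS.trans (filter_subset _ _), hSk, fun A hA B hB hne => ?_⟩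
  obtain ⟨hAF, hxA⟩ := mem_filter.1 (hS hA)
  obtain ⟨hBF, hxB⟩ := mem_filter.1 (hS hB)
  exact .of_card_eq ((hcard A hAF).trans (hcard B hBF).symm) hne ⟨x, mem_inter.2 ⟨hxA, hxB⟩⟩

theorem weakly_cross_free_uniform {α : Type*} [DecidableEq α]
    (X : Finset α) (k ℓ : ℕ) (hk : 2 ≤ k) (hℓ : 1 ≤ ℓ)
    (F : Finset (Finset α)) (hFX : ∀ A ∈ F, A ⊆ X)
    (hcard : ∀ A ∈ F, A.card = ℓ)
    (hF : WeaklyCrossFreeFam k F) :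
    (F.card : ℝ) ≤ ((k : ℝ) - 1) * X.card / ℓ := by
  have hcount : F.card * ℓ ≤ X.card * (k - 1) :=
    card_mul_le_card_mul (fun A x => x ∈ A)
      (fun A hA => by
        rw [← hcard A hA]
        exact card_le_card fun x hx => (mem_bipartiteAbove _).2 ⟨hFX A hA hx, hx⟩)
      (fun x _ => Nat.le_sub_one_of_lt (hF.card_filter_mem_lt hcard x))
  rw [le_div_iff₀ (by exact_mod_cast hℓ), ← Nat.cast_pred (by omega),
    mul_comm (_ : ℝ) (X.card : ℝ)]
  exact_mod_cast hcount
end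

section
/- Let k ≥ 2 be an integer, let X be a finite set of size n ≥ 2, and let F ⊆ 2^X be a weakly-k-cross-free family that is extremal, i.e. for every nonempty finite set X' with |X'| ≤ n and every weakly-k-cross-free family F' ⊆ 2^{X'} one has |F'| / |X'| ≤ |F| / n. Then for every x ∈ X, the number of sets A ∈ F with x ∉ A and A ∪ {x} ∈ F is at least |F| / n. -/
open Finset

/-- Weak crossing is inherited from the traces after deleting a point. -/
theorem WeaklyCrossing.of_erase {α : Type*} [DecidableEq α] {A B : Finset α} {x : α}
    (h : WeaklyCrossing (A.erase x) (B.erase x)) : WeaklyCrossing A B := by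
  obtain ⟨⟨a, ha⟩, ⟨b, hb⟩, ⟨c, hc⟩⟩ := h
  exact ⟨⟨a, by grind⟩, ⟨b, by grind⟩, ⟨c, by grind⟩⟩

/-- Deleting a point from every member preserves weak `k`-cross-freeness. -/
theorem WeaklyCrossFreeFam.image_erase {α : Type*} [DecidableEq α] {k : ℕ}
    {F : Finset (Finset α)} (hF : WeaklyCrossFreeFam k F) (x : α) :
    WeaklyCrossFreeFam k (F.image fun A => A.erase x) := by
  rintro ⟨S, hS, hcard, hcross⟩
  have hlift : ∀ A : Finset α, ∃ B, A ∈ S → B ∈ F ∧ B.erase x = A := by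
    intro A
    by_cases hA : A ∈ S
    · obtain ⟨B, hB, hBA⟩ := mem_image.mp (hS hA)
      exact ⟨B, fun _ => ⟨hB, hBA⟩⟩
    · exact ⟨∅, fun h => absurd h hA⟩
  choose g hg using hlift
  refine hF ⟨S.image g, ?_, ?_, ?_⟩
  · intro B hB
    obtain ⟨A, hA, rfl⟩ := mem_image.mp hB
    exact (hg A hA).1
  · rw [card_image_of_injOn, hcard]
    intro A hA B hB hAB
    rw [← (hg A hA).2, hAB, (hg B hB).2]
  · intro C hC D hD hCD
    obtain ⟨A, hA, rfl⟩ := mem_image.mp (mem_coe.mp hC)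
    obtain ⟨B, hB, rfl⟩ := mem_image.mp (mem_coe.mp hD)
    apply WeaklyCrossing.of_erase (x := x)
    rw [(hg A hA).2, (hg B hB).2]
    exact hcross hA hB fun h => hCD (congrArg g h)

/-- Deleting `x` identifies at most one pair for each `A` with `A` and `A ∪ {x}` both present. -/
theorem card_le_card_image_erase_add {α : Type*} [DecidableEq α]
    (F : Finset (Finset α)) (x : α) :
    F.card ≤ (F.image fun A => A.erase x).card +
      (F.filter fun A => x ∉ A ∧ insert x A ∈ F).card := by
  have hinj : Set.InjOn (fun A : Finset α => A.erase x)
      (F.filter fun A => ¬ (x ∉ A ∧ insert x A ∈ F)) := by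
    intro A hA B hB hAB
    simp only [coe_filter, Set.mem_ofPred_eq] at hA hB hAB
    by_cases hxA : x ∈ A <;> by_cases hxB : x ∈ B
    · rw [← insert_erase hxA, hAB, insert_erase hxB]
    · rw [erase_eq_of_notMem hxB] at hAB
      exact absurd ⟨hxB, by rw [← hAB, insert_erase hxA]; exact hA.1⟩ hB.2
    · rw [erase_eq_of_notMem hxA] at hAB
      exact absurd ⟨hxA, by rw [hAB, insert_erase hxB]; exact hB.1⟩ hA.2
    · rwa [erase_eq_of_notMem hxA, erase_eq_of_notMem hxB] at hAB
  have hle := card_le_card (image_subset_image (f := fun A : Finset α => A.erase x)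
    (filter_subset (fun A => ¬ (x ∉ A ∧ insert x A ∈ F)) F))
  rw [card_image_of_injOn hinj] at hle
  have hsum := card_filter_add_card_filter_not (s := F) (fun A => x ∉ A ∧ insert x A ∈ F)
  omega

/-- In an extremal weakly-`k`-cross-free family `F ⊆ 2^X`, for every `x ∈ X` there are
at least `|F|/n` sets `A ∈ F` with `x ∉ A` and `A ∪ {x} ∈ F`. -/
theorem extremal_many_augmentable {α : Type} [DecidableEq α]
    (k : ℕ) (hk : 2 ≤ k)
    (X : Finset α) (hn : 2 ≤ X.card)
    (F : Finset (Finset α)) (hFX : ∀ A ∈ F, A ⊆ X)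
    (hF : WeaklyCrossFreeFam k F)
    (hext : ∀ (β : Type) [DecidableEq β] (X' : Finset β) (F' : Finset (Finset β)),
      X'.Nonempty → X'.card ≤ X.card → (∀ A ∈ F', A ⊆ X') →
      WeaklyCrossFreeFam k F' →
      (F'.card : ℝ) / X'.card ≤ (F.card : ℝ) / X.card)
    (x : α) (hx : x ∈ X) :
    (F.card : ℝ) / X.card ≤
      ((F.filter (fun A => x ∉ A ∧ insert x A ∈ F)).card : ℝ) := by
  have hcard : (X.erase x).card + 1 = X.card := card_erase_add_one hx
  have hratio := hext α (X.erase x) (F.image fun A => A.erase x)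
    (card_pos.mp (by omega)) (by omega)
    (by
      intro B hB
      obtain ⟨A, hA, rfl⟩ := mem_image.mp hB
      exact erase_subset_erase x (hFX A hA))
    (hF.image_erase x)
  have hcount : (F.card : ℝ) ≤ ((F.image fun A => A.erase x).card : ℝ) +
      ((F.filter fun A => x ∉ A ∧ insert x A ∈ F).card : ℝ) := by
    exact_mod_cast card_le_card_image_erase_add F x
  have hpos : (0 : ℝ) < (X.erase x).card := by
    exact_mod_cast (by omega : 0 < (X.erase x).card)
  have hX : (X.card : ℝ) = (X.erase x).card + 1 := by exact_mod_cast hcard.symm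
  rw [div_le_iff₀ hpos] at hratio
  have hF_eq : (F.card : ℝ) / X.card * (X.erase x).card + (F.card : ℝ) / X.card = F.card := by
    rw [hX]
    field_simp
  linarith
end
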